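/- arXiv:2407.10190 — 4 statements merged into one kernel-verified Lean document; each statement's English description precedes it below -/
import Mathlib

section
/- For each ordinal Ω and each natural number n: (i) V_n(Ω) is closed under finite intersections; (ii) V_n(Ω) ⊆ V_{n+1}(Ω); (iii) if A ∈ H_n(Ω) then {α < Ω : ℓ(α) ∈ A} ∈ H_{n+1}(Ω); (iv) H_n(Ω) is closed under the boolean operations (union, intersection, and complement relative to Ω). -/
open Ordinal Set Filter

/-- `X` is ultimately periodic in `Ω` with offset length `δ`, period length `π`
and exponent `lam`. -/
def UPWith (X : Set Ordinal) (Ω δ π lam : Ordinal) : Prop :=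
  δ < Ω ∧ 0 < π ∧ Order.IsSuccLimit lam ∧ Ω = δ + π * lam ∧
    ∀ γ < lam, ∀ ξ < π, (δ + π * γ + ξ ∈ X ↔ δ + ξ ∈ X)

/-- `X` is ultimately periodic in `Ω` with offset length `δ` and period length `π`. -/
def UPIn (X : Set Ordinal) (Ω δ π : Ordinal) : Prop := ∃ lam, UPWith X Ω δ π lam

/-- `X` is ultimately periodic in `Ω`. -/
def UP (X : Set Ordinal) (Ω : Ordinal) : Prop := ∃ δ π, UPIn X Ω δ π

/-- `X` is periodic in `Ω` with period length `π`. -/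
def PeriodicIn (X : Set Ordinal) (Ω π : Ordinal) : Prop := UPIn X Ω 0 π

/-- `H₀(Ω)`: the family of subsets of `Ω` that are hereditarily periodic in `Ω`. -/
def H0 (Ω : Ordinal) : Set (Set Ordinal) :=
  {X | X ⊆ Set.Iio Ω ∧ ∀ β ≤ Ω, Order.IsSuccLimit β → UP (X ∩ Set.Iio β) β}

/-- `ℓ(α)`: the last (smallest) exponent in the Cantor normal form of `α`, with `ℓ(0) = 0`. -/
noncomputable def ell (α : Ordinal) : Ordinal :=
  (((Ordinal.CNF Ordinal.omega0 α).getLast?).map Prod.fst).getD 0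

/-- The derived-set operator of a topology `t`. -/
def dSet {X : Type*} (t : TopologicalSpace X) (S : Set X) : Set X :=
  {x | @AccPt X t x (Filter.principal S)}

/-- `d₀`: the derived-set operator of the order (interval) topology on the ordinals. -/
noncomputable def d0 : Set Ordinal → Set Ordinal := dSet inferInstance

/-- Icard's topology `ϑ_n` on the ordinals. -/
noncomputable def icard (n : ℕ) : TopologicalSpace Ordinal :=
  TopologicalSpace.generateFrom
    ({U | IsOpen U} ∪
      {U | ∃ m : ℕ, 1 ≤ m ∧ m ≤ n ∧ ∃ β : Ordinal, U = {α | β < ell^[m] α}})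

/-- `d_n`: the derived-set operator of Icard's topology `ϑ_n`. -/
noncomputable def dIcard (n : ℕ) : Set Ordinal → Set Ordinal := dSet (icard n)

/-- The base family `V_n(Ω)` of `n`-periodic subsets of `Ω`. -/
def Vn : ℕ → Ordinal → Set (Set Ordinal)
  | 0, Ω => H0 Ω
  | (n+1), Ω => {S | ∃ B ∈ H0 Ω, ∃ A ∈ Vn n Ω, S = B ∩ {α | α < Ω ∧ ell α ∈ A}}

/-- `H_n(Ω)`: finite unions of members of `V_n(Ω)`, the `n`-periodic subsets of `Ω`. -/
def Hn (n : ℕ) (Ω : Ordinal) : Set (Set Ordinal) :=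
  {S | ∃ F : Finset (Set Ordinal), ↑F ⊆ Vn n Ω ∧ S = ⋃₀ ↑F}

universe u

/-- Strong periodicity beyond `δ`, on a tail of length `θ`. -/
def PG (X : Set Ordinal.{u}) (θ δ π : Ordinal.{u}) : Prop :=
  ∀ γ y, π * γ + y < θ → (δ + (π * γ + y) ∈ X ↔ δ + y ∈ X)

theorem PG.mul {X : Set Ordinal.{u}} {θ δ π : Ordinal.{u}} (h : PG X θ δ π) (m : Ordinal.{u}) :
    PG X θ δ (π * m) := by
  intro γ y hy
  rw [mul_assoc] at hy ⊢
  exact h _ _ hy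

theorem tail_exists {β : Ordinal.{u}} (hβ : Order.IsSuccLimit β) :
    ∃ η ρ : Ordinal.{u}, ρ ≠ 0 ∧ β = η + ω ^ ρ := by
  let S : Set Ordinal.{u} := {t | t ≠ 0 ∧ ∃ η, β = η + t}
  have hS : S.Nonempty := ⟨β, hβ.ne_bot, 0, by simp⟩
  obtain ⟨h0, η, hη⟩ := csInf_mem hS
  set t := sInf S with ht
  have hp : IsPrincipal (· + ·) t := by
    rw [isPrincipal_add_iff_add_left_eq_self]
    intro a ha
    have hat := Ordinal.add_sub_cancel_of_le ha.le
    have hm : t - a ∈ S := by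
      refine ⟨?_, η + a, ?_⟩
      · intro h; rw [h, add_zero] at hat; exact ha.ne hat
      · rw [add_assoc, hat]; exact hη
    have h1 : t ≤ t - a := csInf_le' hm
    have h2 : t - a ≤ t := Ordinal.sub_le_self _ _
    have h3 : t - a = t := le_antisymm h2 h1
    rwa [h3] at hat
  rcases isPrincipal_add_iff_zero_or_omega0_opow.1 hp with h | ⟨ρ, hρ⟩
  · exact absurd h h0
  · refine ⟨η, ρ, ?_, ?_⟩
    · rintro rfl
      have h1 : t = 1 := by rw [← hρ]; simp
      rw [h1] at hη
      rw [hη] at hβ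
      rw [← Order.succ_eq_add_one] at hβ
      exact Order.not_isSuccLimit_succ _ hβ
    · simpa [hρ] using hη

theorem UP.toPG {X : Set Ordinal.{u}} {η ρ : Ordinal.{u}} (h : UP X (η + ω ^ ρ)) :
    ∃ e π, e < ω ^ ρ ∧ 0 < π ∧ π < ω ^ ρ ∧ PG X (ω ^ ρ) (η + e) π := by
  obtain ⟨δ, π, lam, hδ, hπ, hl, heq, hper⟩ := h
  have hlim : Order.IsSuccLimit (π * lam) := isSuccLimit_mul_right hπ hl
  have hlt : η < δ + π * lam := by
    rw [← heq]; exact lt_add_of_pos_right _ (opow_pos _ omega0_pos)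
  obtain ⟨d, hd, hηd⟩ := (lt_add_iff_of_isSuccLimit hlim).1 hlt
  obtain ⟨g, hg, hdg⟩ := (lt_mul_iff_of_isSuccLimit hl).1 hd
  have hηg : η ≤ δ + π * g := hηd.le.trans (by gcongr)
  have he := Ordinal.add_sub_cancel_of_le hηg
  set e := δ + π * g - η with hedef
  have hll : Order.IsSuccLimit (lam - g) := isSuccLimit_sub hl.isSuccPrelimit hg
  have hgl := Ordinal.add_sub_cancel_of_le hg.le
  set l := lam - g with hldef
  have hel : e + π * l = ω ^ ρ := by
    have : η + (e + π * l) = η + ω ^ ρ := by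
      rw [← add_assoc, he, heq, add_assoc, ← mul_add, hgl]
    exact add_left_cancel this
  have hpl : 0 < π * l := mul_pos hπ hll.bot_lt
  have helt : e < ω ^ ρ := by
    rw [← hel]; exact lt_add_of_pos_right _ hpl
  have hpil : π * l = ω ^ ρ := by
    have := add_omega0_opow helt
    rw [← hel] at this
    have h2 := add_left_cancel this
    exact h2.symm.trans hel
  refine ⟨e, π, helt, hπ, ?_, ?_⟩
  · rw [← hpil]
    exact lt_mul_of_one_lt_right hπ (one_lt_of_isSuccLimit hll)
  · have key : ∀ γ y, π * γ + y < π * lam → (δ + (π * γ + y) ∈ X ↔ δ + y % π ∈ X) := by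
      intro γ y hy
      have hr : y % π < π := mod_lt _ hπ.ne'
      have e1 : π * γ + y = π * (γ + y / π) + y % π := by
        rw [mul_add, add_assoc, div_add_mod]
      rw [e1] at hy ⊢
      have : γ + y / π < lam := by
        by_contra hc
        have h2 : π * lam ≤ π * (γ + y / π) := by gcongr; exact not_lt.1 hc
        exact absurd hy (not_lt.2 (h2.trans le_self_add))
      rw [← add_assoc]
      exact hper _ this _ hr
    intro γ y hy
    rw [← hpil] at hy
    rw [he]
    have t1 : π * (g + γ) + y < π * lam := by
      rw [mul_add, add_assoc, ← hgl, mul_add]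
      gcongr
    have t2 : π * g + y < π * lam := by
      rw [← hgl, mul_add]
      gcongr
      exact le_add_self.trans_lt hy
    have k1 := key _ _ t1
    have k2 := key _ _ t2
    rw [mul_add, add_assoc, ← add_assoc] at k1
    rw [← add_assoc] at k2
    exact k1.trans k2.symm

theorem PG.toUP {X Y : Set Ordinal.{u}} {θ δ π l : Ordinal.{u}} (hX : PG X θ δ π)
    (hY : PG Y θ δ π) (hπ : 0 < π) (hl : Order.IsSuccLimit l) (h : π * l = θ) :
    UP (X ∩ Y) (δ + θ) := by
  refine ⟨δ, π, l, ?_, hπ, hl, by rw [h], ?_⟩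
  · rw [← h]; exact lt_add_of_pos_right _ (mul_pos hπ hl.bot_lt)
  · intro γ hγ ξ hξ
    have : π * γ + ξ < θ := by
      rw [← h]
      calc π * γ + ξ < π * γ + π := by gcongr
        _ = π * Order.succ γ := by rw [mul_succ]
        _ ≤ π * l := by gcongr; exact Order.succ_le_of_lt hγ
    have h1 := hX γ ξ this
    have h2 := hY γ ξ this
    rw [← add_assoc] at h1 h2
    simp only [Set.mem_inter_iff, h1, h2]

theorem pi_mul_nat {τ r k : Ordinal.{u}} (hk : k < ω) (hr : r < ω ^ τ) (n : ℕ) :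
    (ω ^ τ * k + r) * n + ω ^ τ = ω ^ τ + ω ^ τ * (k * n) := by
  obtain ⟨k, rfl⟩ := lt_omega0.1 hk
  have comm : ∀ m : ℕ, ω ^ τ * (m : Ordinal.{u}) + ω ^ τ = ω ^ τ + ω ^ τ * m := by
    intro m
    have : ((m : Ordinal.{u}) + 1) = 1 + m := by exact_mod_cast (Nat.add_comm m 1)
    calc _ = ω ^ τ * ((m : Ordinal.{u}) + 1) := by rw [mul_add, mul_one]
      _ = _ := by rw [this, mul_add, mul_one]
  induction n with
  | zero => simp
  | succ n ih =>
    have : (ω ^ τ * (k : Ordinal.{u}) + r) * ((n + 1 : ℕ) : Ordinal.{u})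
        = (ω ^ τ * (k : Ordinal.{u}) + r) * n + (ω ^ τ * k + r) := by
      push_cast; rw [mul_add, mul_one]
    rw [this, add_assoc, add_assoc, add_omega0_opow hr, comm k, ← add_assoc, ih, add_assoc,
      ← mul_add]
    push_cast
    rw [mul_add (k : Ordinal.{u}), mul_one]

theorem PG.succ_norm {X : Set Ordinal.{u}} {τ δ π : Ordinal.{u}} (h : PG X (ω ^ (τ + 1)) δ π)
    (h0 : 0 < π) (h1 : π < ω ^ (τ + 1)) :
    ∃ k : ℕ, 0 < k ∧ PG X (ω ^ (τ + 1)) (δ + ω ^ τ) (ω ^ τ * k) := by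
  have hpos : 0 < ω ^ τ := opow_pos τ omega0_pos
  have hτ : ω ^ τ < ω ^ (τ + 1) := (opow_lt_opow_iff_right one_lt_omega0).2 (lt_add_one τ)
  have hsucc : ω ^ (τ + 1) = ω ^ τ * ω := by rw [opow_add, opow_one]
  -- enlarge the period
  set m := ω ^ τ / π + 1 with hm
  have hπm := h.mul m
  have hm1 : ω ^ τ ≤ π * m := by
    rw [hm, mul_add, mul_one]; exact (lt_mul_div_add _ h0.ne').le
  have hm2 : π * m < ω ^ (τ + 1) := by
    rw [hm, mul_add, mul_one]
    exact isPrincipal_add_omega0_opow _ ((mul_div_le _ _).trans_lt hτ) h1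
  set p := π * m with hp
  have hk : p / ω ^ τ < ω := by
    rw [← lt_mul_iff_div_lt hpos.ne', ← hsucc]; exact hm2
  have hr : p % ω ^ τ < ω ^ τ := mod_lt _ hpos.ne'
  have hpe := div_add_mod p (ω ^ τ)
  set r := p % ω ^ τ
  obtain ⟨k, hkk⟩ := lt_omega0.1 hk
  rw [hkk] at hpe
  refine ⟨k, ?_, ?_⟩
  · rcases Nat.eq_zero_or_pos k with rfl | h
    · simp only [Nat.cast_zero, mul_zero, zero_add] at hpe
      rw [← hpe] at hm1
      exact absurd hr (not_lt.2 hm1)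
    · exact h
  · intro γ y hy
    have hkpos : 0 < k := by
      rcases Nat.eq_zero_or_pos k with rfl | h
      · simp only [Nat.cast_zero, mul_zero, zero_add] at hpe
        rw [← hpe] at hm1
        exact absurd hr (not_lt.2 hm1)
      · exact h
    have hγ : γ < ω := by
      by_contra hc
      have h2 : ω ^ τ * (k : Ordinal.{u}) * ω ≤ ω ^ τ * k * γ := by
        gcongr; exact not_lt.1 hc
      rw [mul_assoc, natCast_mul_omega0 hkpos, ← hsucc] at h2
      exact absurd hy (not_lt.2 (h2.trans le_self_add))
    obtain ⟨n, rfl⟩ := lt_omega0.1 hγ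
    have e := pi_mul_nat (natCast_lt_omega0 k) hr n
    rw [hpe] at e
    have e2 : p * n + (ω ^ τ + y) = ω ^ τ + (ω ^ τ * k * n + y) := by
      rw [← add_assoc, e, mul_assoc, add_assoc]
    have := hπm n (ω ^ τ + y) (by
      rw [e2]; exact isPrincipal_add_omega0_opow _ hτ hy)
    rw [e2] at this
    rw [add_assoc, add_assoc]
    exact this

theorem PG.succ_shift {X : Set Ordinal.{u}} {τ δ : Ordinal.{u}} {k : ℕ} (hk : 0 < k)
    (h : PG X (ω ^ (τ + 1)) δ (ω ^ τ * k)) {e : Ordinal.{u}} (he : e < ω ^ (τ + 1)) :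
    PG X (ω ^ (τ + 1)) (δ + (e + ω ^ τ)) (ω ^ τ * k) := by
  have hpos : 0 < ω ^ τ := opow_pos τ omega0_pos
  have hsucc : ω ^ (τ + 1) = ω ^ τ * ω := by rw [opow_add, opow_one]
  have hτ : ω ^ τ < ω ^ (τ + 1) := (opow_lt_opow_iff_right one_lt_omega0).2 (lt_add_one τ)
  have hq : e / ω ^ τ < ω := by
    rw [← lt_mul_iff_div_lt hpos.ne', ← hsucc]; exact he
  have hr : e % ω ^ τ < ω ^ τ := mod_lt _ hpos.ne'
  obtain ⟨q, hqq⟩ := lt_omega0.1 hq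
  have hee : e + ω ^ τ = ω ^ τ * ((q + 1 : ℕ) : Ordinal.{u}) := by
    conv_lhs => rw [← div_add_mod e (ω ^ τ)]
    rw [add_assoc, add_omega0_opow hr, hqq]
    push_cast; rw [mul_add, mul_one]
  have hlt : e + ω ^ τ < ω ^ (τ + 1) := isPrincipal_add_omega0_opow _ he hτ
  rw [hee] at hlt ⊢
  intro γ y hy
  have hγ : γ < ω := by
    by_contra hc
    have h2 : ω ^ τ * (k : Ordinal.{u}) * ω ≤ ω ^ τ * k * γ := by
      gcongr; exact not_lt.1 hc
    rw [mul_assoc, natCast_mul_omega0 hk, ← hsucc] at h2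
    exact absurd hy (not_lt.2 (h2.trans le_self_add))
  obtain ⟨n, rfl⟩ := lt_omega0.1 hγ
  have e2 : ω ^ τ * k * n + (ω ^ τ * ((q + 1 : ℕ) : Ordinal.{u}) + y)
      = ω ^ τ * ((q + 1 : ℕ) : Ordinal.{u}) + (ω ^ τ * k * n + y) := by
    rw [← add_assoc, ← add_assoc, mul_assoc, ← mul_add, ← mul_add]
    have : (k : Ordinal.{u}) * n + ((q + 1 : ℕ) : Ordinal.{u})
        = ((q + 1 : ℕ) : Ordinal.{u}) + k * n := by
      exact_mod_cast Nat.add_comm (k * n) (q + 1)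
    rw [this]
  have := h n _ (by rw [e2]; exact isPrincipal_add_omega0_opow _ hlt hy)
  rw [e2] at this
  rw [add_assoc, add_assoc]
  exact this

theorem PG.lim_norm {X : Set Ordinal.{u}} {ρ δ π : Ordinal.{u}} (h : PG X (ω ^ ρ) δ π)
    (hρ : Order.IsSuccLimit ρ) (h0 : 0 < π) (h1 : π < ω ^ ρ) :
    ∃ b < ρ, PG X (ω ^ ρ) δ (ω ^ b) := by
  refine ⟨Order.succ (log ω π), hρ.succ_lt ?_, ?_⟩
  · exact (lt_opow_iff_log_lt one_lt_omega0 h0.ne').1 h1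
  · rw [← mul_eq_opow_log_succ h0.ne' isPrincipal_mul_omega0
      (by exact_mod_cast natCast_lt_omega0 2)]
    exact h.mul _

theorem PG.opow_le {X : Set Ordinal.{u}} {θ δ b c : Ordinal.{u}} (h : PG X θ δ (ω ^ b))
    (hbc : b ≤ c) : PG X θ δ (ω ^ c) := by
  rw [← Ordinal.add_sub_cancel_of_le hbc, opow_add]
  exact h.mul _

theorem PG.lim_shift {X : Set Ordinal.{u}} {ρ δ b : Ordinal.{u}} (hb : b < ρ)
    (h : PG X (ω ^ ρ) δ (ω ^ b)) {e : Ordinal.{u}} (he : e < ω ^ ρ) :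
    PG X (ω ^ ρ) (δ + (e + ω ^ b)) (ω ^ b) := by
  have hpos : 0 < ω ^ b := opow_pos b omega0_pos
  have hτ : ω ^ b < ω ^ ρ := (opow_lt_opow_iff_right one_lt_omega0).2 hb
  have hr : e % ω ^ b < ω ^ b := mod_lt _ hpos.ne'
  have hee : e + ω ^ b = ω ^ b * (e / ω ^ b + 1) := by
    conv_lhs => rw [← div_add_mod e (ω ^ b)]
    rw [add_assoc, add_omega0_opow hr, mul_add, mul_one]
  have hlt : e + ω ^ b < ω ^ ρ := isPrincipal_add_omega0_opow _ he hτ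
  rw [hee] at hlt ⊢
  generalize e / ω ^ b + 1 = q at hlt ⊢
  intro γ y hy
  have e2 : ω ^ b * q + (ω ^ b * γ + y) = ω ^ b * (q + γ) + y := by
    rw [mul_add, add_assoc]
  have k1 := h (q + γ) y (by rw [← e2]; exact isPrincipal_add_omega0_opow _ hlt hy)
  have k2 := h q y (isPrincipal_add_omega0_opow _ hlt (le_add_self.trans_lt hy))
  rw [← e2] at k1
  rw [add_assoc, add_assoc]
  exact k1.trans k2.symm

/-- Two offsets can be moved to a common one. -/
theorem common_offset {θ e f w : Ordinal.{u}} (he : e < θ) (hf : f < θ) :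
    ∃ g < θ, (∃ a < θ, e + (a + w) = g + w) ∧ (∃ a < θ, f + (a + w) = g + w) := by
  refine ⟨max e f, max_lt he hf, ⟨max e f - e, ?_, ?_⟩, ⟨max e f - f, ?_, ?_⟩⟩
  · exact (Ordinal.sub_le_self _ _).trans_lt (max_lt he hf)
  · rw [← add_assoc, Ordinal.add_sub_cancel_of_le (le_max_left _ _)]
  · exact (Ordinal.sub_le_self _ _).trans_lt (max_lt he hf)
  · rw [← add_assoc, Ordinal.add_sub_cancel_of_le (le_max_right _ _)]

theorem UP.inter {X Y : Set Ordinal.{u}} {β : Ordinal.{u}} (hβ : Order.IsSuccLimit β)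
    (hX : UP X β) (hY : UP Y β) : UP (X ∩ Y) β := by
  obtain ⟨η, ρ, hρ, rfl⟩ := tail_exists hβ
  obtain ⟨e, p, he, hp0, hp, hXp⟩ := hX.toPG
  obtain ⟨f, q, hf, hq0, hq, hYq⟩ := hY.toPG
  rcases zero_or_succ_or_isSuccLimit ρ with h | ⟨τ, rfl⟩ | hlim
  · exact absurd h hρ
  · rw [Order.succ_eq_add_one] at *
    have hτ : ω ^ τ < ω ^ (τ + 1) := (opow_lt_opow_iff_right one_lt_omega0).2 (lt_add_one τ)
    obtain ⟨k, hk, hXk⟩ := hXp.succ_norm hp0 hp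
    obtain ⟨l, hl, hYl⟩ := hYq.succ_norm hq0 hq
    rw [add_assoc] at hXk hYl
    obtain ⟨g, hg, ⟨a, ha, hag⟩, ⟨b, hb, hbg⟩⟩ := common_offset (w := ω ^ τ)
      (isPrincipal_add_omega0_opow _ he hτ) (isPrincipal_add_omega0_opow _ hf hτ)
    have hX' := (hXk.succ_shift hk ha).mul l
    have hY' := (hYl.succ_shift hl hb).mul k
    simp only [] at hag hbg
    rw [add_assoc, hag] at hX'
    rw [add_assoc, hbg] at hY'
    have hc : (l : Ordinal.{u}) * k = k * l := by exact_mod_cast Nat.mul_comm l k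
    rw [mul_assoc] at hX' hY'
    rw [hc] at hY'
    have hkl : ((k * l : ℕ) : Ordinal.{u}) = k * l := by push_cast; rfl
    rw [← hkl] at hX' hY'
    have hkl0 : 0 < k * l := Nat.mul_pos hk hl
    have := hX'.toUP (l := ω) hY'
      (mul_pos (opow_pos τ omega0_pos) (by exact_mod_cast hkl0)) isSuccLimit_omega0
      (by rw [mul_assoc, natCast_mul_omega0 hkl0, opow_add, opow_one])
    rwa [add_assoc, add_omega0_opow (isPrincipal_add_omega0_opow _ hg hτ)] at this
  · obtain ⟨b, hb, hXb⟩ := hXp.lim_norm hlim hp0 hp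
    obtain ⟨c, hc, hYc⟩ := hYq.lim_norm hlim hq0 hq
    replace hXb := hXb.opow_le (le_max_left b c)
    replace hYc := hYc.opow_le (le_max_right b c)
    have hd : max b c < ρ := max_lt hb hc
    set d := max b c
    have hτ : ω ^ d < ω ^ ρ := (opow_lt_opow_iff_right one_lt_omega0).2 hd
    obtain ⟨g, hg, ⟨a, ha, hag⟩, ⟨b', hb', hbg⟩⟩ := common_offset (w := ω ^ d) he hf
    have hX' := hXb.lim_shift hd ha
    have hY' := hYc.lim_shift hd hb'
    rw [add_assoc, hag] at hX'
    rw [add_assoc, hbg] at hY'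
    have hsub : Order.IsSuccLimit (ρ - d) := isSuccLimit_sub hlim.isSuccPrelimit hd
    have := hX'.toUP (l := ω ^ (ρ - d)) hY' (opow_pos d omega0_pos)
      (isSuccLimit_opow one_lt_omega0 hsub)
      (by rw [← opow_add, Ordinal.add_sub_cancel_of_le hd.le])
    rwa [add_assoc, add_omega0_opow (isPrincipal_add_omega0_opow _ hg hτ)] at this

theorem H0_inter {Ω : Ordinal.{u}} {X Y : Set Ordinal.{u}} (hX : X ∈ H0 Ω) (hY : Y ∈ H0 Ω) :
    X ∩ Y ∈ H0 Ω := by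
  refine ⟨fun a ha => hX.1 ha.1, fun β hβ hl => ?_⟩
  have := (hX.2 β hβ hl).inter hl (hY.2 β hβ hl)
  rwa [← Set.inter_inter_distrib_right] at this

theorem H0_compl {Ω : Ordinal.{u}} {X : Set Ordinal.{u}} (hX : X ∈ H0 Ω) :
    Set.Iio Ω \ X ∈ H0 Ω := by
  refine ⟨Set.diff_subset, fun β hβ hl => ?_⟩
  obtain ⟨δ, π, lam, hδ, hπ, hlam, heq, hper⟩ := hX.2 β hβ hl
  refine ⟨δ, π, lam, hδ, hπ, hlam, heq, ?_⟩
  have hlt : ∀ γ < lam, ∀ ξ < π, δ + π * γ + ξ < β := by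
    intro γ hγ ξ hξ
    rw [heq, add_assoc]
    gcongr
    calc π * γ + ξ < π * γ + π := by gcongr
        _ = π * Order.succ γ := by rw [mul_succ]
        _ ≤ π * lam := by gcongr; exact Order.succ_le_of_lt hγ
  intro γ hγ ξ hξ
  have h1 := hlt γ hγ ξ hξ
  have h2 := hlt 0 hlam.bot_lt ξ hξ
  rw [mul_zero, add_zero] at h2
  have h3 := hper γ hγ ξ hξ
  simp only [Set.mem_inter_iff, Set.mem_Iio, Set.mem_diff, h1, h2, h1.trans_le hβ,
    h2.trans_le hβ, and_true, true_and] at h3 ⊢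
  exact not_congr h3

theorem H0_Iio (Ω : Ordinal.{u}) : Set.Iio Ω ∈ H0 Ω := by
  refine ⟨subset_rfl, fun β hβ hl => ?_⟩
  refine ⟨0, 1, β, hl.bot_lt, zero_lt_one, hl, by simp, ?_⟩
  intro γ hγ ξ hξ
  have : ξ = 0 := Ordinal.lt_one_iff_zero.1 hξ
  subst this
  have h0 : 0 < β := hl.bot_lt
  simp [hγ, hγ.trans_le hβ, h0, h0.trans_le hβ]

theorem H0_empty (Ω : Ordinal.{u}) : ∅ ∈ H0 Ω := by
  simpa using H0_compl (H0_Iio Ω)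

theorem H0_union {Ω : Ordinal.{u}} {X Y : Set Ordinal.{u}} (hX : X ∈ H0 Ω) (hY : Y ∈ H0 Ω) :
    X ∪ Y ∈ H0 Ω := by
  have := H0_compl (H0_inter (H0_compl hX) (H0_compl hY))
  convert this using 1
  have h1 := hX.1
  have h2 := hY.1
  ext a
  have h1 := @h1 a
  have h2 := @h2 a
  simp only [Set.mem_union, Set.mem_diff, Set.mem_inter_iff]
  tauto

theorem ell_le (α : Ordinal.{u}) : ell α ≤ α := by
  unfold ell
  cases h : (Ordinal.CNF ω α).getLast? with
  | none => simp
  | some x =>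
    have hx : x ∈ Ordinal.CNF ω α := List.mem_of_getLast? h
    simpa using (CNF.fst_le_log hx).trans (log_le_self _ _)

theorem Vn_subset_Iio {Ω : Ordinal.{u}} : ∀ {n : ℕ} {A : Set Ordinal.{u}}, A ∈ Vn n Ω →
    A ⊆ Set.Iio Ω
  | 0, _, h => h.1
  | _ + 1, _, ⟨_, hB, _, _, hS⟩ => by
    rw [hS]; exact fun a ha => hB.1 ha.1

theorem Vn_inter {Ω : Ordinal.{u}} (n : ℕ) : ∀ A ∈ Vn n Ω, ∀ B ∈ Vn n Ω, A ∩ B ∈ Vn n Ω := by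
  induction n with
  | zero => exact fun A hA B hB => H0_inter hA hB
  | succ n ih =>
    rintro _ ⟨B, hB, A, hA, rfl⟩ _ ⟨B', hB', A', hA', rfl⟩
    refine ⟨B ∩ B', H0_inter hB hB', A ∩ A', ih _ hA _ hA', ?_⟩
    ext a
    simp only [Set.mem_inter_iff, Set.mem_setOf_eq]
    tauto

theorem Vn_succ {Ω : Ordinal.{u}} (n : ℕ) : Vn n Ω ⊆ Vn (n + 1) Ω := by
  induction n with
  | zero =>
    intro B hB
    refine ⟨B, hB, Set.Iio Ω, H0_Iio Ω, ?_⟩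
    ext a
    constructor
    · intro ha
      have : a < Ω := hB.1 ha
      exact ⟨ha, this, (ell_le a).trans_lt this⟩
    · exact fun h => h.1
  | succ n ih =>
    rintro _ ⟨B, hB, A, hA, rfl⟩
    exact ⟨B, hB, A, ih hA, rfl⟩

theorem H0_subset_Vn {Ω : Ordinal.{u}} (n : ℕ) : H0 Ω ⊆ Vn n Ω := by
  induction n with
  | zero => exact subset_rfl
  | succ n ih => exact ih.trans (Vn_succ n)

theorem Vn_subset_Hn {Ω : Ordinal.{u}} {n : ℕ} {A : Set Ordinal.{u}} (h : A ∈ Vn n Ω) :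
    A ∈ Hn n Ω := ⟨{A}, by simpa using h, by simp⟩

theorem Hn_union {Ω : Ordinal.{u}} {n : ℕ} {A B : Set Ordinal.{u}} (hA : A ∈ Hn n Ω)
    (hB : B ∈ Hn n Ω) : A ∪ B ∈ Hn n Ω := by
  classical
  obtain ⟨F, hF, rfl⟩ := hA
  obtain ⟨G, hG, rfl⟩ := hB
  refine ⟨F ∪ G, ?_, ?_⟩
  · rw [Finset.coe_union]; exact Set.union_subset hF hG
  · rw [Finset.coe_union, Set.sUnion_union]

theorem Hn_empty {Ω : Ordinal.{u}} {n : ℕ} : ∅ ∈ Hn n Ω := ⟨∅, by simp, by simp⟩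

theorem Hn_induction {Ω : Ordinal.{u}} {n : ℕ} {P : Set Ordinal.{u} → Prop} (h0 : P ∅)
    (h1 : ∀ A ∈ Vn n Ω, ∀ B, P B → P (A ∪ B)) : ∀ A ∈ Hn n Ω, P A := by
  classical
  rintro _ ⟨F, hF, rfl⟩
  induction F using Finset.induction_on with
  | empty => simpa using h0
  | insert a s has ih =>
    rw [Finset.coe_insert] at hF ⊢
    rw [Set.sUnion_insert]
    exact h1 _ (hF (Set.mem_insert _ _)) _ (ih (fun x hx => hF (Set.mem_insert_of_mem _ hx)))

theorem Hn_inter {Ω : Ordinal.{u}} {n : ℕ} : ∀ A ∈ Hn n Ω, ∀ B ∈ Hn n Ω, A ∩ B ∈ Hn n Ω := by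
  apply Hn_induction
  · intro B _; rw [Set.empty_inter]; exact Hn_empty
  · intro A hA C hC B hB
    rw [Set.union_inter_distrib_right]
    refine Hn_union ?_ (hC B hB)
    revert B
    apply Hn_induction
    · rw [Set.inter_empty]; exact Hn_empty
    · intro B hB D hD
      rw [Set.inter_union_distrib_left]
      exact Hn_union (Vn_subset_Hn (Vn_inter n _ hA _ hB)) hD

theorem Hn_ell {Ω : Ordinal.{u}} {n : ℕ} : ∀ A ∈ Hn n Ω,
    {α : Ordinal.{u} | α < Ω ∧ ell α ∈ A} ∈ Hn (n + 1) Ω := by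
  apply Hn_induction
  · convert Hn_empty (Ω := Ω) (n := n + 1) using 1
    ext a; simp
  · intro A hA B hB
    have h1 : Set.Iio Ω ∩ {α : Ordinal.{u} | α < Ω ∧ ell α ∈ A} ∈ Vn (n + 1) Ω :=
      ⟨_, H0_Iio Ω, A, hA, rfl⟩
    convert Hn_union (Vn_subset_Hn h1) hB using 1
    ext a
    simp only [Set.mem_union, Set.mem_inter_iff, Set.mem_setOf_eq, Set.mem_Iio]
    tauto

theorem Hn_compl {Ω : Ordinal.{u}} (n : ℕ) : ∀ A ∈ Hn n Ω, Set.Iio Ω \ A ∈ Hn n Ω := by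
  induction n with
  | zero =>
    apply Hn_induction
    · rw [Set.diff_empty]; exact Vn_subset_Hn (H0_Iio Ω)
    · intro A hA B hB
      rw [← Set.diff_inter_diff]
      exact Hn_inter _ (Vn_subset_Hn (H0_compl hA)) _ hB
  | succ n ih =>
    apply Hn_induction
    · rw [Set.diff_empty]; exact Vn_subset_Hn (H0_subset_Vn _ (H0_Iio Ω))
    · intro S hS C hC
      rw [← Set.diff_inter_diff]
      refine Hn_inter _ ?_ _ hC
      obtain ⟨B, hB, A, hA, rfl⟩ := hS
      have h1 : Set.Iio Ω \ B ∈ Hn (n + 1) Ω := Vn_subset_Hn (H0_subset_Vn _ (H0_compl hB))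
      have h2 := Hn_ell _ (ih A (Vn_subset_Hn hA))
      convert Hn_union h1 h2 using 1
      ext a
      have h3 : a < Ω → ell a < Ω := (ell_le a).trans_lt
      simp only [Set.mem_union, Set.mem_inter_iff, Set.mem_setOf_eq, Set.mem_Iio, Set.mem_diff]
      tauto

/-- Basic properties of `V_n(Ω)` and `H_n(Ω)`. -/
theorem Vn_Hn_basic (Ω : Ordinal) (n : ℕ) :
    (∀ A ∈ Vn n Ω, ∀ B ∈ Vn n Ω, A ∩ B ∈ Vn n Ω) ∧
    (Vn n Ω ⊆ Vn (n + 1) Ω) ∧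
    (∀ A ∈ Hn n Ω, {α : Ordinal | α < Ω ∧ ell α ∈ A} ∈ Hn (n + 1) Ω) ∧
    (∀ A ∈ Hn n Ω, ∀ B ∈ Hn n Ω,
      A ∪ B ∈ Hn n Ω ∧ A ∩ B ∈ Hn n Ω ∧ Set.Iio Ω \ A ∈ Hn n Ω) :=
  ⟨Vn_inter n, Vn_succ n, Hn_ell, fun A hA B hB =>
    ⟨Hn_union hA hB, Hn_inter A hA B hB, Hn_compl n A hA⟩⟩
end

section
/- If Ω₁ < Ω₂ are ordinals, then for every natural number n: V_n(Ω₁) = {A ∩ Ω₁ : A ∈ V_n(Ω₂)} and H_n(Ω₁) = {A ∩ Ω₁ : A ∈ H_n(Ω₂)}. -/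
open Ordinal Set Filter

theorem ell_le_self (α : Ordinal) : ell α ≤ α := by
  unfold ell
  cases hc : (Ordinal.CNF Ordinal.omega0 α).getLast? with
  | none => simp
  | some x =>
    have hx : x ∈ Ordinal.CNF Ordinal.omega0 α := List.mem_of_getLast? hc
    simp only [Option.map_some, Option.getD_some]
    exact (Ordinal.CNF.fst_le_log hx).trans (Ordinal.log_le_self _ _)

theorem H0_lift {Ω₁ Ω₂ : Ordinal} (h : Ω₁ < Ω₂) {X : Set Ordinal} (hX : X ∈ H0 Ω₁) :
    X ∈ H0 Ω₂ := by
  obtain ⟨hs, hp⟩ := hX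
  refine ⟨fun x hx => lt_trans (hs hx) h, fun β _ hβ => ?_⟩
  rcases le_or_gt β Ω₁ with hle | hlt
  · exact hp β hle hβ
  · have e : Ω₁ + (β - Ω₁) = β := Ordinal.add_sub_cancel_of_le hlt.le
    refine ⟨Ω₁, 1, β - Ω₁, hlt, zero_lt_one, Ordinal.isSuccLimit_sub hβ.isSuccPrelimit hlt, ?_, ?_⟩
    · rw [one_mul, e]
    · intro γ _ ξ _
      constructor
      · rintro ⟨hx, -⟩
        have := hs hx
        rw [Set.mem_Iio, add_assoc] at this
        exact absurd this (not_lt.2 le_self_add)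
      · rintro ⟨hx, -⟩
        exact absurd (Set.mem_Iio.1 (hs hx)) (not_lt.2 le_self_add)

theorem H0_res {Ω₁ Ω₂ : Ordinal} (h : Ω₁ < Ω₂) {X : Set Ordinal} (hX : X ∈ H0 Ω₂) :
    X ∩ Set.Iio Ω₁ ∈ H0 Ω₁ := by
  refine ⟨Set.inter_subset_right, fun β hβ hl => ?_⟩
  have e : X ∩ Set.Iio Ω₁ ∩ Set.Iio β = X ∩ Set.Iio β := by
    rw [Set.inter_assoc, Set.inter_eq_self_of_subset_right (Set.Iio_subset_Iio hβ)]
  rw [e]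
  exact hX.2 β (hβ.trans h.le) hl

theorem Vn_res (Ω₁ Ω₂ : Ordinal) (h : Ω₁ < Ω₂) (n : ℕ) :
    Vn n Ω₁ = (fun A => A ∩ Set.Iio Ω₁) '' Vn n Ω₂ := by
  induction n with
  | zero =>
    ext X
    constructor
    · intro hX
      exact ⟨X, H0_lift h hX, Set.inter_eq_self_of_subset_left hX.1⟩
    · rintro ⟨Y, hY, rfl⟩
      exact H0_res h hY
  | succ n ih =>
    ext X
    constructor
    · rintro ⟨B, hB, A, hA, rfl⟩
      rw [ih] at hA
      obtain ⟨A', hA', rfl⟩ := hA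
      refine ⟨_, ⟨B, H0_lift h hB, A', hA', rfl⟩, ?_⟩
      ext α
      have h1 := ell_le_self α
      simp only [Set.mem_inter_iff, Set.mem_setOf_eq, Set.mem_Iio]
      constructor
      · rintro ⟨⟨a, b, c⟩, d⟩
        exact ⟨a, d, c, h1.trans_lt d⟩
      · rintro ⟨a, d, c, -⟩
        exact ⟨⟨a, d.trans h, c⟩, d⟩
    · rintro ⟨_, ⟨B, hB, A, hA, rfl⟩, rfl⟩
      refine ⟨_, H0_res h hB, A ∩ Set.Iio Ω₁, ih ▸ ⟨A, hA, rfl⟩, ?_⟩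
      ext α
      have h1 := ell_le_self α
      simp only [Set.mem_inter_iff, Set.mem_setOf_eq, Set.mem_Iio]
      constructor
      · rintro ⟨⟨a, b, c⟩, d⟩
        exact ⟨⟨a, d⟩, d, c, h1.trans_lt d⟩
      · rintro ⟨⟨a, -⟩, d, c, -⟩
        exact ⟨⟨a, d.trans h, c⟩, d⟩

/-- Restriction: for `Ω₁ < Ω₂`, `V_n(Ω₁)` and `H_n(Ω₁)` are the restrictions to
`Ω₁` of `V_n(Ω₂)` and `H_n(Ω₂)`. -/
theorem Vn_Hn_restrict (Ω₁ Ω₂ : Ordinal) (h : Ω₁ < Ω₂) (n : ℕ) :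
    Vn n Ω₁ = (fun A => A ∩ Set.Iio Ω₁) '' Vn n Ω₂ ∧
    Hn n Ω₁ = (fun A => A ∩ Set.Iio Ω₁) '' Hn n Ω₂ := by
  classical
  have hV := Vn_res Ω₁ Ω₂ h n
  refine ⟨hV, ?_⟩
  have key : ∀ G : Finset (Set Ordinal),
      (⋃₀ (↑G : Set (Set Ordinal))) ∩ Set.Iio Ω₁ =
        ⋃₀ (↑(G.image (fun A => A ∩ Set.Iio Ω₁)) : Set (Set Ordinal)) := by
    intro G
    rw [Finset.coe_image, Set.sUnion_image, Set.sUnion_eq_biUnion, Set.iUnion₂_inter]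
  ext S
  constructor
  · rintro ⟨F, hF, rfl⟩
    rw [hV, Finset.subset_set_image_iff] at hF
    obtain ⟨G, hG, rfl⟩ := hF
    exact ⟨_, ⟨G, hG, rfl⟩, key G⟩
  · rintro ⟨_, ⟨G, hG, rfl⟩, rfl⟩
    refine ⟨G.image (fun A => A ∩ Set.Iio Ω₁), ?_, key G⟩
    rw [hV, Finset.coe_image]
    exact Set.image_mono hG
end

section
/- Let Ω be an ordinal and let τ be a topology on the set of ordinals below Ω that is finer than (extends) the subspace topology induced on Ω by Icard's topology ϑ₁, and let d_τ denote the derived-set operator of τ. Then for every B ∈ H₀(Ω) and every set A of ordinals, d_τ(B ∩ {α < Ω : ℓ(α) ∈ A}) = d_τ(B) ∩ d_τ({α < Ω : ℓ(α) ∈ A}). -/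
open Ordinal Set Filter

theorem omega_opow_dvd_iff (e : Ordinal) (y : Ordinal) (hy : y ≠ 0) :
    omega0 ^ e ∣ y ↔ e ≤ ell y := by
  induction y using WellFoundedLT.induction with
  | _ y ih =>
  have hdm : omega0 ^ log omega0 y * (y / omega0 ^ log omega0 y) + y % omega0 ^ log omega0 y = y :=
    Ordinal.div_add_mod _ _
  have hrlt : y % omega0 ^ log omega0 y < omega0 ^ log omega0 y :=
    Ordinal.mod_lt _ (opow_ne_zero _ omega0_ne_zero)
  have hle : omega0 ^ log omega0 y ≤ y := opow_log_le_self _ hy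
  have hcnf := Ordinal.CNF.ne_zero (b := omega0) hy
  have key : omega0 ^ e ∣ y → e ≤ log omega0 y := by
    intro h
    have h1 : omega0 ^ e ≤ y := Ordinal.le_of_dvd hy h
    have h2 : y < omega0 ^ Order.succ (log omega0 y) := lt_opow_succ_log_self one_lt_omega0 _
    have h3 := (opow_lt_opow_iff_right one_lt_omega0).1 (h1.trans_lt h2)
    exact Order.lt_succ_iff.1 h3
  by_cases hr : y % omega0 ^ log omega0 y = 0
  · have hell : ell y = log omega0 y := by
      unfold ell
      rw [hcnf, hr]
      simp
    rw [hell]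
    refine ⟨key, fun h => ?_⟩
    rw [← hdm, hr, add_zero]
    exact (opow_dvd_opow _ h).mul_right _
  · have hry : y % omega0 ^ log omega0 y < y := hrlt.trans_le hle
    have hell : ell y = ell (y % omega0 ^ log omega0 y) := by
      unfold ell
      rw [hcnf, Ordinal.CNF.ne_zero (b := omega0) hr, List.getLast?_cons_cons]
    rw [hell, ← ih _ hry hr]
    constructor
    · intro h
      have h1 := (opow_dvd_opow omega0 (key h)).mul_right (y / omega0 ^ log omega0 y)
      rw [← hdm] at h
      exact (Ordinal.dvd_add_iff h1).1 h
    · intro h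
      have h0 : e ≤ log omega0 y := by
        have h1 := (Ordinal.le_of_dvd hr h).trans_lt hrlt
        exact ((opow_lt_opow_iff_right one_lt_omega0).1 h1).le
      have h1 := (opow_dvd_opow omega0 h0).mul_right (y / omega0 ^ log omega0 y)
      rw [← hdm]
      exact (Ordinal.dvd_add_iff h1).2 h

theorem absorb_add (e r c : Ordinal) (hr : r < omega0 ^ e) (hc : c ≠ 0) :
    r + omega0 ^ e * c = omega0 ^ e * c := by
  obtain ⟨c', rfl⟩ : ∃ c', c = 1 + c' :=
    ⟨c - 1, (Ordinal.add_sub_cancel_of_le (Ordinal.one_le_iff_ne_zero.2 hc)).symm⟩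
  rw [mul_add, mul_one, ← add_assoc, add_omega0_opow hr]

theorem add_decomp (e d c : Ordinal) (hc : c ≠ 0) :
    d + omega0 ^ e * c = omega0 ^ e * (d / omega0 ^ e + c) := by
  conv_lhs => rw [← Ordinal.div_add_mod d (omega0 ^ e)]
  rw [add_assoc, absorb_add _ _ _ (Ordinal.mod_lt _ (opow_ne_zero _ omega0_ne_zero)) hc, mul_add]

theorem mul_omega_eq (p : Ordinal) (hp : 0 < p) :
    p * omega0 = omega0 ^ (Order.succ (log omega0 p)) := by
  apply le_antisymm
  · rw [mul_le_iff_of_isSuccLimit isSuccLimit_omega0]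
    intro b hb
    obtain ⟨n, rfl⟩ := lt_omega0.1 hb
    apply le_of_lt
    have hlt : p < omega0 ^ (Order.succ (log omega0 p)) := lt_opow_succ_log_self one_lt_omega0 _
    induction n with
    | zero =>
      rw [Nat.cast_zero, mul_zero]
      exact opow_pos _ omega0_pos
    | succ n ih =>
      rw [Nat.cast_succ, mul_add, mul_one]
      exact isPrincipal_add_omega0_opow _ (ih (nat_lt_omega0 n)) hlt
  · rw [opow_succ]
    exact mul_le_mul_left (opow_log_le_self _ hp.ne') _

theorem up_local (B : Set Ordinal) (x : Ordinal) (h : UP (B ∩ Set.Iio x) x) :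
    ∃ δ < x, ∃ β < ell x, ∀ y, δ < y → y < x → β < ell y → (y ∈ B ↔ δ ∈ B) := by
  obtain ⟨δ, p, lam, hδ, hp, hlam, hx, hper⟩ := h
  have hw := mul_omega_eq p hp
  refine ⟨δ, hδ, log omega0 p, ?_, ?_⟩
  · obtain ⟨l, rfl⟩ := (isSuccLimit_iff_omega0_dvd.1 hlam).2
    have hl : l ≠ 0 := by
      rintro rfl
      simp at hlam
    rw [← Order.succ_le_iff, ← omega_opow_dvd_iff _ _ (ne_bot_of_gt hδ), hx, ← mul_assoc, hw,
      add_decomp _ _ _ hl]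
    exact dvd_mul_right _ _
  · intro y hdy hyx hy
    rw [← Order.succ_le_iff, ← omega_opow_dvd_iff _ _ (ne_bot_of_gt hdy)] at hy
    obtain ⟨b, hb⟩ := hy
    set e := Order.succ (log omega0 p) with he
    have hw0 : omega0 ^ e ≠ 0 := opow_ne_zero _ omega0_ne_zero
    have hab : δ / omega0 ^ e < b := by
      rw [Ordinal.div_lt hw0, ← hb]; exact hdy
    obtain ⟨c, rfl⟩ : ∃ c, b = δ / omega0 ^ e + c :=
      ⟨b - δ / omega0 ^ e, (Ordinal.add_sub_cancel_of_le hab.le).symm⟩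
    have hc : c ≠ 0 := by
      rintro rfl
      simp at hab
    rw [← add_decomp _ _ _ hc, ← hw, mul_assoc] at hb
    have hlt : omega0 * c < lam := by
      rw [hb, hx] at hyx
      exact lt_of_mul_lt_mul_left' (lt_of_add_lt_add_left hyx)
    have := hper _ hlt 0 hp
    rw [add_zero, add_zero, ← hb] at this
    simpa [hyx, hδ] using this

/-- If `τ` is a topology on the ordinals below `Ω` finer than the subspace
topology induced by Icard's topology `ϑ₁`, then for every `B ∈ H₀(Ω)` and any
set `A`, `d_τ(B ∩ ℓ⁻¹(A)) = d_τ(B) ∩ d_τ(ℓ⁻¹(A))`. -/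
theorem dtau_ell_distrib (Ω : Ordinal) (τ : TopologicalSpace ↥(Set.Iio Ω))
    (hτ : τ ≤ (icard 1).induced (Subtype.val : ↥(Set.Iio Ω) → Ordinal))
    (B : Set Ordinal) (hB : B ∈ H0 Ω) (A : Set Ordinal) :
    dSet τ (Subtype.val ⁻¹' (B ∩ {α : Ordinal | ell α ∈ A}))
      = dSet τ (Subtype.val ⁻¹' B)
        ∩ dSet τ (Subtype.val ⁻¹' {α : Ordinal | ell α ∈ A}) := by
  classical
  ext x
  simp only [dSet, Set.mem_inter_iff, Set.mem_setOf_eq]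
  constructor
  · intro h
    exact ⟨h.mono (Filter.principal_mono.2 fun y hy => hy.1),
      h.mono (Filter.principal_mono.2 fun y hy => hy.2)⟩
  rintro ⟨hxB, hxA⟩
  have hopen : ∀ U : Set Ordinal, @IsOpen _ (icard 1) U → x.1 ∈ U →
      (Subtype.val ⁻¹' U : Set ↥(Set.Iio Ω)) ∈ @nhds _ τ x := by
    intro U hU hx
    refine @IsOpen.mem_nhds _ τ x _ ?_ hx
    exact hτ _ ⟨U, hU, rfl⟩
  have hord : ∀ U : Set Ordinal, IsOpen U → @IsOpen _ (icard 1) U := fun U hU =>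
    TopologicalSpace.isOpen_generateFrom_of_mem (Or.inl hU)
  have hell : ∀ β : Ordinal, @IsOpen _ (icard 1) {α | β < ell α} := fun β =>
    TopologicalSpace.isOpen_generateFrom_of_mem (Or.inr ⟨1, le_rfl, le_rfl, β, rfl⟩)
  have hsucc : (Subtype.val ⁻¹' (Set.Iio (Order.succ x.1)) : Set ↥(Set.Iio Ω)) ∈ @nhds _ τ x :=
    hopen _ (hord _ isOpen_Iio) (Order.lt_succ x.1)
  rw [@accPt_iff_nhds] at hxB hxA ⊢
  have hlim : Order.IsSuccLimit x.1 := by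
    by_contra hnl
    have hiso : (Subtype.val ⁻¹' {x.1} : Set ↥(Set.Iio Ω)) ∈ @nhds _ τ x :=
      hopen _ (hord _ (SuccOrder.isOpen_singleton_iff.2 hnl)) rfl
    obtain ⟨y, ⟨hy, -⟩, hne⟩ := hxB _ hiso
    exact hne (Subtype.ext hy)
  obtain ⟨δ, hδ, β, hβ, hloc⟩ := up_local B x.1 (hB.2 x.1 (le_of_lt x.2) hlim)
  have hN := Filter.inter_mem (Filter.inter_mem hsucc (hopen _ (hord _ (isOpen_Ioi (a := δ))) hδ))
    (hopen _ (hell β) hβ)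
  have hiff : ∀ y : ↥(Set.Iio Ω), y ≠ x → y ∈ (Subtype.val ⁻¹' (Set.Iio (Order.succ x.1)) ∩
      Subtype.val ⁻¹' (Set.Ioi δ) ∩ Subtype.val ⁻¹' {α | β < ell α} : Set ↥(Set.Iio Ω)) →
      (y.1 ∈ B ↔ δ ∈ B) := by
    rintro y hne ⟨⟨h1, h2⟩, h3⟩
    exact hloc y.1 h2 (lt_of_le_of_ne (Order.lt_succ_iff.1 h1) fun h => hne (Subtype.ext h)) h3
  have hδB : δ ∈ B := by
    obtain ⟨y, ⟨hy, hyB⟩, hne⟩ := hxB _ hN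
    exact (hiff y hne hy).1 hyB
  intro U hU
  obtain ⟨y, ⟨hy, hyA⟩, hne⟩ := hxA _ (Filter.inter_mem hU hN)
  exact ⟨y, ⟨hy.1, (hiff y hne hy.2).2 hδB, hyA⟩, hne⟩
end

section
/- Let Ω be an ordinal and n > 0. If V ∈ H_n(Ω), then for every i ≤ n, d_i(V) ∩ Ω ∈ H_i(Ω). (In particular, the algebra of n-periodic subsets of Ω is closed under the derivative operators of Icard's topologies ϑ₀, …, ϑ_n.) -/
open Ordinal Set Filter

/-! ### Basic facts on `ell` -/

theorem ell_zero : ell 0 = 0 := by simp [ell]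

theorem ell_rec {x : Ordinal} (hx : x ≠ 0) :
    ell x = if x % ω ^ log ω x = 0 then log ω x else ell (x % ω ^ log ω x) := by
  unfold ell
  rw [Ordinal.CNF.ne_zero hx]
  split_ifs with h
  · rw [h]; simp
  · rw [Ordinal.CNF.ne_zero h]
    simp [List.getLast?_cons_cons]

theorem omega_pow_pos (a : Ordinal) : 0 < ω ^ a := opow_pos a omega0_pos

theorem omega_pow_ne (a : Ordinal) : ω ^ a ≠ 0 := (omega_pow_pos a).ne'

theorem ell_spec_aux (x : Ordinal) : x ≠ 0 →
    ell x ≤ log ω x ∧ ∃ c, x = ω ^ ell x * (c + 1) := by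
  refine Ordinal.CNF.rec ω (fun h => (h rfl).elim) (fun x hx ih _ => ?_) x
  have hdm := div_add_mod x (ω ^ log ω x)
  have hpos : 0 < x / ω ^ log ω x := div_opow_log_pos ω hx
  have hlt : x / ω ^ log ω x < ω := div_opow_log_lt x one_lt_omega0
  obtain ⟨n, hn⟩ := lt_omega0.1 hlt
  rw [ell_rec hx]
  split_ifs with h
  · refine ⟨le_rfl, ?_⟩
    cases n with
    | zero => simp [hn] at hpos
    | succ n =>
      refine ⟨n, ?_⟩
      rw [h, hn, add_zero] at hdm
      exact_mod_cast hdm.symm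
  · obtain ⟨h1, c, hc⟩ := ih h
    have hle : log ω (x % ω ^ log ω x) ≤ log ω x :=
      log_mono_right _ (mod_opow_log_lt_self ω hx).le
    refine ⟨h1.trans hle, ?_⟩
    set e := ell (x % ω ^ log ω x)
    obtain ⟨f, hf⟩ := exists_add_of_le (h1.trans hle)
    refine ⟨ω ^ f * (x / ω ^ log ω x) + c, ?_⟩
    rw [add_assoc, mul_add, ← hc, ← mul_assoc, ← opow_add, ← hf, hdm]

theorem ell_spec {x : Ordinal} (hx : x ≠ 0) : ∃ c, x = ω ^ ell x * (c + 1) :=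
  (ell_spec_aux x hx).2

theorem omega_pow_succ_ne {e e' c c' : Ordinal} (h : e < e') :
    ω ^ e * (c + 1) ≠ ω ^ e' * (c' + 1) := by
  intro heq
  obtain ⟨f, rfl⟩ := exists_add_of_le (Order.add_one_le_of_lt h)
  rw [opow_add, opow_add, opow_one, mul_assoc, mul_assoc] at heq
  have := mul_left_cancel₀ (omega_pow_ne e) heq
  have hl : Order.IsSuccLimit (ω * (ω ^ f * (c' + 1))) :=
    isSuccLimit_mul_left isSuccLimit_omega0
      (mul_pos (omega_pow_pos f) (by simp))
  rw [← this] at hl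
  simp at hl

theorem ell_omega_mul (e c : Ordinal) : ell (ω ^ e * (c + 1)) = e := by
  have hne : ω ^ e * (c + 1) ≠ 0 := mul_ne_zero (omega_pow_ne e) (by simp)
  obtain ⟨c', hc'⟩ := ell_spec hne
  rcases lt_trichotomy (ell (ω ^ e * (c + 1))) e with h | h | h
  · exact (omega_pow_succ_ne h hc'.symm).elim
  · exact h
  · exact (omega_pow_succ_ne h hc').elim

theorem ell_omega_pow (e : Ordinal) : ell (ω ^ e) = e := by
  simpa using ell_omega_mul e 0

theorem ell_le_of_dvd {x e : Ordinal} (hx : x ≠ 0) (h : ω ^ e ∣ x) : e ≤ ell x := by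
  obtain ⟨q, rfl⟩ := h
  have hq : q ≠ 0 := by rintro rfl; simp at hx
  obtain ⟨c, hc⟩ := ell_spec hq
  conv_rhs => rw [hc, ← mul_assoc, ← opow_add, ell_omega_mul]
  exact le_self_add

theorem dvd_of_le_ell {x e : Ordinal} (h : e ≤ ell x) : ω ^ e ∣ x := by
  by_cases hx : x = 0
  · simp [hx]
  obtain ⟨c, hc⟩ := ell_spec hx
  rw [hc]
  exact (opow_dvd_opow ω h).mul_right _

theorem omega_ell_le {x : Ordinal} (hx : x ≠ 0) : ω ^ ell x ≤ x :=
  le_of_dvd hx (dvd_of_le_ell le_rfl)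

theorem ell_add (a : Ordinal) {b : Ordinal} (hb : b ≠ 0) : ell (a + b) = ell b := by
  obtain ⟨c, hc⟩ := ell_spec hb
  set e := ell b with he
  have hmod := mod_lt a (omega_pow_ne e)
  have h0 : a % ω ^ e + ω ^ e = ω ^ e := add_omega0_opow hmod
  have h2 : c + 1 = 1 + (c + 1 - 1) := (Ordinal.add_sub_cancel_of_le (by simp)).symm
  have h3 : a % ω ^ e + ω ^ e * (c + 1) = ω ^ e * (c + 1) := by
    rw [h2, mul_add, mul_one, ← add_assoc, h0]
  have h1 : a + b = ω ^ e * (a / ω ^ e + c + 1) := by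
    conv_lhs => rw [← div_add_mod a (ω ^ e), hc, add_assoc, h3]
    rw [add_assoc (a / ω ^ e), mul_add _ (a / ω ^ e)]
  rw [h1, ell_omega_mul]

theorem ell_pos_of_limit {x : Ordinal} (hx : Order.IsSuccLimit x) : 0 < ell x := by
  have h := isSuccPrelimit_iff_omega0_dvd.1 hx.isSuccPrelimit
  have := ell_le_of_dvd (e := 1) hx.ne_bot (by simpa using h)
  exact lt_of_lt_of_le zero_lt_one this

theorem exists_ell_split {x : Ordinal} (hx : x ≠ 0) : ∃ c, x = c + ω ^ ell x := by
  obtain ⟨c, hc⟩ := ell_spec hx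
  refine ⟨ω ^ ell x * c, ?_⟩
  rw [mul_add, mul_one] at hc
  exact hc

/-! ### Periodicity -/

/-- `B` has period `π` from the offset `δ` on, for `lam` many blocks. -/
def Per (B : Set Ordinal) (δ π lam : Ordinal) : Prop :=
  ∀ γ < lam, ∀ ξ < π, (δ + π * γ + ξ ∈ B ↔ δ + ξ ∈ B)

theorem Per.mul {B : Set Ordinal} {δ π μ lam : Ordinal} (h : Per B δ π (μ * lam)) :
    Per B δ (π * μ) lam := by
  intro γ hγ ξ hξ
  obtain ⟨q, hq, r, hr, rfl⟩ := lt_mul_iff.1 hξ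
  have h1 : δ + π * μ * γ + (π * q + r) = δ + π * (μ * γ + q) + r := by
    rw [mul_add, mul_assoc]; simp only [add_assoc]
  have h2 : μ * γ + q < μ * lam := lt_mul_iff.2 ⟨γ, hγ, q, hq, rfl⟩
  have h3 : q < μ * lam := lt_of_le_of_lt le_add_self h2
  rw [h1, h _ h2 r hr, ← add_assoc, h _ h3 r hr]

theorem Per.shift {B : Set Ordinal} {δ π a lam : Ordinal} (h : Per B δ π (a + lam))
    (hl : 0 < lam) : Per B (δ + π * a) π lam := by
  intro γ hγ ξ hξ
  have h1 := h (a + γ) (by simpa using hγ) ξ hξ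
  have h2 := h a (by simpa using hl) ξ hξ
  rw [h2, ← h1, mul_add, ← add_assoc]

theorem mul_omega_eq_s19 {π : Ordinal} (hπ : π ≠ 0) : π * ω = ω ^ (log ω π + 1) := by
  rw [opow_add, opow_one]
  apply le_antisymm
  · obtain ⟨n, hn⟩ := lt_omega0_opow_succ.1 (lt_opow_succ_log_self one_lt_omega0 π)
    have hn0 : 0 < n := by
      rcases Nat.eq_zero_or_pos n with rfl | h
      · simp at hn
      · exact h
    calc π * ω ≤ ω ^ log ω π * n * ω := by gcongr
      _ = ω ^ log ω π * ω := by
        rw [mul_assoc, natCast_mul_omega0 hn0]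
  · gcongr
    exact opow_log_le_self ω hπ

/-- Normal form for ultimate periodicity. -/
theorem up_normal {B : Set Ordinal} {β : Ordinal} (h : UP B β) :
    (∃ δ π, 0 < π ∧ β = δ + π * ω ∧ Per B δ π ω) ∨
    (∃ δ τ σ : Ordinal, Order.IsSuccLimit σ ∧ β = δ + ω ^ (τ + σ) ∧ Per B δ (ω ^ τ) (ω ^ σ)) := by
  obtain ⟨δ, π, lam, -, hπ, hlam, rfl, hP⟩ := h
  change Per B δ π lam at hP
  have hl0 : 0 < ell lam := ell_pos_of_limit hlam
  obtain ⟨a, ha⟩ := exists_ell_split (x := lam) hlam.ne_bot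
  obtain ⟨s, hs⟩ : ∃ s, ell lam = 1 + s := exists_add_of_le (Order.one_le_iff_pos.2 hl0)
  rw [hs] at ha
  have hP' : Per B (δ + π * a) π (ω ^ (1 + s)) := by
    rw [ha] at hP
    exact hP.shift (omega_pow_pos _)
  have hΩ : δ + π * lam = (δ + π * a) + π * ω ^ (1 + s) := by
    rw [ha, mul_add, add_assoc]
  rw [hΩ]
  generalize δ + π * a = δ' at *
  rcases zero_or_succ_or_isSuccLimit s with rfl | ⟨t, rfl⟩ | hlim
  · left
    refine ⟨δ', π, hπ, by simp, by simpa using hP'⟩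
  · left
    have he : ω ^ (1 + Order.succ t) = ω ^ (1 + t) * ω := by
      rw [Order.succ_eq_add_one, ← add_assoc, opow_add, opow_one]
    rw [he] at hP' ⊢
    exact ⟨δ', π * ω ^ (1 + t), mul_pos hπ (omega_pow_pos _), by rw [mul_assoc], hP'.mul⟩
  · right
    have he : π * ω ^ (1 + s) = ω ^ ((log ω π + 1) + s) := by
      rw [opow_add, opow_one, ← mul_assoc, mul_omega_eq_s19 hπ.ne', ← opow_add]
    refine ⟨δ', log ω π + 1, s, hlim, by rw [he], ?_⟩
    rw [← mul_omega_eq_s19 hπ.ne']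
    apply Per.mul
    rwa [opow_add, opow_one] at hP'

/-- A local operator satisfying the uniformity condition at block boundaries preserves `H0`. -/
theorem H0_of_local {B F : Set Ordinal} {Ω : Ordinal} (hB : B ∈ H0 Ω)
    (hloc : ∀ a b x, 0 < x → (∀ y < x, (a + y ∈ B ↔ b + y ∈ B)) → (a + x ∈ F ↔ b + x ∈ F))
    (hconst : ∀ δ τ σ : Ordinal, Order.IsSuccLimit σ → Per B δ (ω ^ τ) (ω ^ σ) →
      ∃ τ' : Ordinal, τ ≤ τ' ∧ τ' < τ + σ ∧ ∀ q, 0 < q → ω ^ τ' * q < ω ^ (τ + σ) →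
        (δ + ω ^ τ' * q ∈ F ↔ δ + ω ^ τ' ∈ F)) :
    F ∩ Set.Iio Ω ∈ H0 Ω := by
  refine ⟨Set.inter_subset_right, fun β hβ hlim => ?_⟩
  have hup := up_normal (hB.2 β hβ hlim)
  -- reduction to periodicity of `B` and `F`
  have key : ∀ δ π lam, 0 < π → Order.IsSuccLimit lam → β = δ + π * lam → Per F δ π lam →
      UP (F ∩ Set.Iio Ω ∩ Set.Iio β) β := by
    intro δ π lam hπ hlam hβe hP
    have hpl : 0 < π * lam := mul_pos hπ hlam.bot_lt
    refine ⟨δ, π, lam, by rw [hβe]; simpa using hpl, hπ, hlam, hβe, fun γ hγ ξ hξ => ?_⟩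
    have hb : ∀ γ < lam, δ + π * γ + ξ < β := fun γ hγ => by
      rw [hβe, add_assoc]
      gcongr
      exact lt_mul_iff.2 ⟨γ, hγ, ξ, hξ, rfl⟩
    have h1 := hb γ hγ
    have h2 := hb 0 hlam.bot_lt
    simp only [mul_zero, add_zero] at h2
    simp only [Set.mem_inter_iff, Set.mem_Iio, h1, h2, h1.trans_le hβ, h2.trans_le hβ, and_true]
    exact hP γ hγ ξ hξ
  have hPB : ∀ δ π lam, 0 < π → β = δ + π * lam → Per (B ∩ Set.Iio β) δ π lam →
      Per B δ π lam := by
    intro δ π lam hπ hβe hP γ hγ ξ hξ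
    have hb : ∀ γ < lam, δ + π * γ + ξ < β := fun γ hγ => by
      rw [hβe, add_assoc]
      gcongr
      exact lt_mul_iff.2 ⟨γ, hγ, ξ, hξ, rfl⟩
    have h1 := hb γ hγ
    have h2 := hb 0 (lt_of_le_of_lt (zero_le) hγ)
    simp only [mul_zero, add_zero] at h2
    have := hP γ hγ ξ hξ
    simpa only [Set.mem_inter_iff, Set.mem_Iio, h1, h2, and_true] using this
  -- interior of blocks
  have hinterior : ∀ δ π lam, Per B δ π lam → ∀ γ < lam, ∀ ξ, 0 < ξ → ξ ≤ π →
      (δ + π * γ + ξ ∈ F ↔ δ + ξ ∈ F) := by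
    intro δ π lam hP γ hγ ξ hξ0 hξ
    exact hloc _ _ _ hξ0 fun y hy => hP γ hγ y (hy.trans_le hξ)
  rcases hup with ⟨δ, π, hπ, hβe, hP⟩ | ⟨δ, τ, σ, hσ, hβe, hP⟩
  · have hP := hPB δ π ω hπ hβe hP
    refine key (δ + π) π ω hπ isSuccLimit_omega0 ?_ ?_
    · rw [hβe, add_assoc]
      conv_lhs => rw [← one_add_omega0, mul_add, mul_one]
    · intro γ hγ ξ hξ
      have hγ' : 1 + γ < ω := by
        have := add_lt_add_right hγ 1
        rwa [one_add_omega0] at this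
      have e1 : δ + π + π * γ + ξ = δ + π * (1 + γ) + ξ := by
        rw [mul_add, mul_one]; simp only [add_assoc]
      have e2 : δ + π + ξ = δ + π * 1 + ξ := by rw [mul_one]
      rcases eq_or_ne ξ 0 with rfl | hξ0
      · obtain ⟨n, rfl⟩ := lt_omega0.1 hγ
        have e3 : δ + π + π * (n : Ordinal) = δ + π * (n : Ordinal) + π := by
          rw [add_assoc, add_assoc]
          congr 1
          have : (1 : Ordinal) + n = n + 1 := by exact_mod_cast Nat.add_comm 1 n
          conv_lhs => rw [← mul_one π, mul_assoc, one_mul, ← mul_add, this, mul_add, mul_one]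
        rw [add_zero, add_zero, e3]
        exact hinterior δ π ω hP n (natCast_lt_omega0 n) π hπ le_rfl
      · have hξ0 := pos_iff_ne_zero.2 hξ0
        rw [e1, e2, hinterior δ π ω hP _ hγ' ξ hξ0 hξ.le,
          hinterior δ π ω hP 1 one_lt_omega0 ξ hξ0 hξ.le]
  · have hP := hPB δ (ω ^ τ) (ω ^ σ) (omega_pow_pos _) (by rw [← opow_add]; exact hβe) hP
    obtain ⟨τ', h1, h2, h3⟩ := hconst δ τ σ hσ hP
    obtain ⟨t, rfl⟩ := exists_add_of_le h1
    obtain ⟨s, hs⟩ := exists_add_of_le h2.le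
    have hs0 : s ≠ 0 := by rintro rfl; simp [hs] at h2
    have hst : σ = t + s := by rwa [add_assoc, add_right_inj] at hs
    have hlim : Order.IsSuccLimit (ω ^ s) := isSuccLimit_opow_left isSuccLimit_omega0 hs0
    have habs : 1 + ω ^ s = ω ^ s := one_add_of_omega0_le (omega0_le_of_isSuccLimit hlim)
    have hP2 : Per B δ (ω ^ (τ + t)) (ω ^ s) := by
      rw [opow_add]
      apply Per.mul
      rwa [← opow_add, ← hst]
    refine key (δ + ω ^ (τ + t)) (ω ^ (τ + t)) (ω ^ s) (omega_pow_pos _) hlim ?_ ?_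
    · rw [hβe, hs, opow_add, add_assoc]
      conv_lhs => rw [← habs, mul_add, mul_one]
    · intro γ hγ ξ hξ
      have hγ' : 1 + γ < ω ^ s := by
        have := add_lt_add_right hγ 1
        rwa [habs] at this
      have e1 : δ + ω ^ (τ + t) + ω ^ (τ + t) * γ + ξ = δ + ω ^ (τ + t) * (1 + γ) + ξ := by
        rw [mul_add, mul_one]; simp only [add_assoc]
      have e2 : δ + ω ^ (τ + t) + ξ = δ + ω ^ (τ + t) * 1 + ξ := by rw [mul_one]
      rcases eq_or_ne ξ 0 with rfl | hξ0
      · rw [e1, add_zero, add_zero]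
        refine h3 (1 + γ) (lt_of_lt_of_le zero_lt_one le_self_add) ?_
        rw [hs, opow_add ω (τ + t) s]
        exact mul_lt_mul_of_pos_left hγ' (omega_pow_pos _)
      · have hξ0 := pos_iff_ne_zero.2 hξ0
        rw [e1, e2, hinterior _ _ _ hP2 _ hγ' ξ hξ0 hξ.le,
          hinterior _ _ _ hP2 1 (one_lt_of_isSuccLimit hlim) ξ hξ0 hξ.le]

/-! ### The operators -/

/-- Points that are limits of elements of `B` whose `ell`-value satisfies `S`. -/
def Cof (B : Set Ordinal) (S : Ordinal → Prop) : Set Ordinal :=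
  {z | ∀ γ < z, ∃ w ∈ B, γ < w ∧ w < z ∧ S (ell w)}

theorem Cof_local_aux {B : Set Ordinal} {S : Ordinal → Prop} {a b x : Ordinal} (hx : 0 < x)
    (h : ∀ y < x, (a + y ∈ B ↔ b + y ∈ B)) (hz : a + x ∈ Cof B S) : b + x ∈ Cof B S := by
  intro γ hγ
  obtain ⟨d, hd, hγd⟩ := (lt_add_iff hx.ne').1 hγ
  obtain ⟨w, hwB, hw1, hw2, hwS⟩ := hz (a + d) (by simpa using hd)
  obtain ⟨y, rfl⟩ := exists_add_of_le (le_self_add.trans hw1.le)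
  have hdy : d < y := by simpa using hw1
  have hyx : y < x := by simpa using hw2
  have hy0 : y ≠ 0 := (lt_of_le_of_lt zero_le hdy).ne'
  refine ⟨b + y, (h y hyx).1 hwB, lt_of_le_of_lt hγd (by simpa using hdy),
    by simpa using hyx, ?_⟩
  rw [ell_add _ hy0] at hwS ⊢
  exact hwS

theorem Cof_local {B : Set Ordinal} {S : Ordinal → Prop} {a b x : Ordinal} (hx : 0 < x)
    (h : ∀ y < x, (a + y ∈ B ↔ b + y ∈ B)) : a + x ∈ Cof B S ↔ b + x ∈ Cof B S :=
  ⟨Cof_local_aux hx h, Cof_local_aux hx fun y hy => (h y hy).symm⟩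

/-- The order derivative of `B ∩ ell ⁻¹ A`. -/
def Der (B A : Set Ordinal) : Set Ordinal := {z | z ≠ 0 ∧ z ∈ Cof B (· ∈ A)}

/-- Points approached by elements of `B` of `ell`-value as large as possible. -/
def Extd (B : Set Ordinal) : Set Ordinal := {z | ∀ t < ell z, z ∈ Cof B (t ≤ ·)}

theorem lt_add_mul_limit {γ δ π l : Ordinal} (hπ : 0 < π) (hl : Order.IsSuccLimit l)
    (h : γ < δ + π * l) : ∃ m < l, γ < δ + π * m := by
  have hlim : Order.IsSuccLimit (π * l) := isSuccLimit_mul_right hπ hl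
  obtain ⟨d, hd, hγ⟩ := (lt_add_iff_of_isSuccLimit hlim).1 h
  obtain ⟨m, hm, hdm⟩ := (lt_mul_iff_of_isSuccLimit hl).1 hd
  exact ⟨m, hm, hγ.trans (by simpa using hdm)⟩

theorem exists_mem_ell {B : Set Ordinal} {δ τ σ y η γ : Ordinal}
    (hP : Per B δ (ω ^ τ) (ω ^ σ)) (hδ : δ ∈ B) (hτ : τ ≤ η) (hη : η < ell y)
    (hy : y ≤ ω ^ (τ + σ)) (hγ : γ < δ + y) : ∃ w ∈ B, γ < w ∧ w < δ + y ∧ ell w = η := by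
  have hy0 : y ≠ 0 := by rintro rfl; simp [ell_zero] at hη
  obtain ⟨g, rfl⟩ : ω ^ (η + 1) ∣ y := dvd_of_le_ell (Order.add_one_le_of_lt hη)
  have hg0 : 0 < g := pos_iff_ne_zero.2 (by rintro rfl; simp at hy0)
  have e : ω ^ (η + 1) * g = ω ^ η * (ω * g) := by rw [opow_add, opow_one, mul_assoc]
  rw [e] at hγ hy ⊢
  have hlim : Order.IsSuccLimit (ω * g) := isSuccLimit_mul_left isSuccLimit_omega0 hg0
  obtain ⟨m, hm, hγm⟩ := lt_add_mul_limit (omega_pow_pos η) hlim hγ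
  have hm1 : m + 1 < ω * g := by
    have := hlim.succ_lt hm
    rwa [Order.succ_eq_add_one] at this
  have hlt : ω ^ η * (m + 1) < ω ^ η * (ω * g) := mul_lt_mul_of_pos_left hm1 (omega_pow_pos η)
  refine ⟨δ + ω ^ η * (m + 1), ?_, ?_, by simpa using hlt, ?_⟩
  · obtain ⟨f, rfl⟩ := exists_add_of_le hτ
    have h1 : ω ^ τ * (ω ^ f * (m + 1)) < ω ^ τ * ω ^ σ := by
      rw [← opow_add, ← mul_assoc, ← opow_add]
      exact hlt.trans_le hy
    have h2 : ω ^ f * (m + 1) < ω ^ σ := lt_of_mul_lt_mul_left h1 zero_le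
    have := (hP _ h2 0 (omega_pow_pos τ)).2 (by simpa using hδ)
    rwa [add_zero, ← mul_assoc, ← opow_add] at this
  · refine hγm.trans_le ?_
    gcongr
    exact le_self_add
  · rw [ell_add _ (mul_ne_zero (omega_pow_ne η) (by simp)), ell_omega_mul]

theorem mem_offset {B : Set Ordinal} {δ τ σ y : Ordinal}
    (hP : Per B δ (ω ^ τ) (ω ^ σ)) (hy : y < ω ^ (τ + σ)) (hτ : τ ≤ ell y) :
    δ + y ∈ B ↔ δ ∈ B := by
  obtain ⟨q, rfl⟩ := dvd_of_le_ell hτ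
  rw [opow_add] at hy
  have h2 : q < ω ^ σ := lt_of_mul_lt_mul_left hy zero_le
  simpa using hP q h2 0 (omega_pow_pos τ)

theorem limit_add_one_lt {τ σ η : Ordinal} (hσ : Order.IsSuccLimit σ) (h : η < τ + σ) :
    η + 1 < τ + σ := by
  have := (isSuccLimit_add τ hσ).succ_lt h
  rwa [Order.succ_eq_add_one] at this

theorem Der_mem_H0 {B A : Set Ordinal} {Ω : Ordinal} (hB : B ∈ H0 Ω) :
    Der B A ∩ Set.Iio Ω ∈ H0 Ω := by
  apply H0_of_local hB
  · intro a b x hx h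
    have h1 : a + x ≠ 0 := (lt_of_lt_of_le hx le_add_self).ne'
    have h2 : b + x ≠ 0 := (lt_of_lt_of_le hx le_add_self).ne'
    simp only [Der, Set.mem_ofPred_eq, h1, h2, ne_eq, not_false_eq_true, true_and]
    exact Cof_local hx h
  · intro δ τ σ hσ hP
    have hττ : τ < τ + σ := by simpa using hσ.bot_lt
    -- it suffices that membership is constantly true or constantly false
    have htrue : ∀ τ' : Ordinal, τ' < τ + σ → (∀ q, 0 < q → ω ^ τ' * q < ω ^ (τ + σ) →
        δ + ω ^ τ' * q ∈ Cof B (· ∈ A)) → ∀ q, 0 < q → ω ^ τ' * q < ω ^ (τ + σ) →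
        (δ + ω ^ τ' * q ∈ Der B A ↔ δ + ω ^ τ' ∈ Der B A) := by
      intro τ' hτ' h q hq hlt
      have h1 := h q hq hlt
      have h2 := h 1 zero_lt_one (by
        rw [mul_one]; exact (opow_lt_opow_iff_right one_lt_omega0).2 hτ')
      rw [mul_one] at h2
      have n1 : δ + ω ^ τ' * q ≠ 0 :=
        (lt_of_lt_of_le (mul_pos (omega_pow_pos τ') hq) le_add_self).ne'
      have n2 : δ + ω ^ τ' ≠ 0 := (lt_of_lt_of_le (omega_pow_pos τ') le_add_self).ne'
      exact ⟨fun _ => ⟨n2, h2⟩, fun _ => ⟨n1, h1⟩⟩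
    by_cases c1 : ∃ ξ, 0 < ξ ∧ ξ < ω ^ τ ∧ δ + ξ ∈ B ∧ ell ξ ∈ A
    · obtain ⟨ξ, hξ0, hξ, hξB, hξA⟩ := c1
      refine ⟨τ + 1, le_self_add, limit_add_one_lt hσ hττ,
        htrue _ (limit_add_one_lt hσ hττ) ?_⟩
      intro q hq hlt γ hγ
      rw [opow_add ω τ 1, opow_one, mul_assoc] at hγ hlt ⊢
      have hlim : Order.IsSuccLimit (ω * q) := isSuccLimit_mul_left isSuccLimit_omega0 hq
      obtain ⟨m, hm, hγm⟩ := lt_add_mul_limit (omega_pow_pos τ) hlim hγ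
      have hlt' : ω ^ τ * m + ξ < ω ^ τ * (ω * q) := lt_mul_iff.2 ⟨m, hm, ξ, hξ, rfl⟩
      have hmσ : m < ω ^ σ := by
        rw [opow_add] at hlt
        exact hm.trans (lt_of_mul_lt_mul_left hlt zero_le)
      refine ⟨δ + ω ^ τ * m + ξ, (hP m hmσ ξ hξ).2 hξB, hγm.trans_le le_self_add, ?_, ?_⟩
      · rw [add_assoc]; simpa using hlt'
      · rw [ell_add _ hξ0.ne']; exact hξA
    by_cases c2 : δ ∈ B ∧ ∃ η ∈ A, τ ≤ η ∧ η < τ + σ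
    · obtain ⟨hδ, η, hηA, hτη, hησ⟩ := c2
      refine ⟨η + 1, hτη.trans le_self_add, limit_add_one_lt hσ hησ,
        htrue _ (limit_add_one_lt hσ hησ) ?_⟩
      intro q hq hlt γ hγ
      have hne : ω ^ (η + 1) * q ≠ 0 := mul_ne_zero (omega_pow_ne _) hq.ne'
      have hell : η < ell (ω ^ (η + 1) * q) :=
        lt_of_lt_of_le (by simp) (ell_le_of_dvd hne (dvd_mul_right _ _))
      obtain ⟨w, h1, h2, h3, h4⟩ := exists_mem_ell hP hδ hτη hell hlt.le hγ
      exact ⟨w, h1, h2, h3, by rw [h4]; exact hηA⟩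
    · have hfalse : ∀ y, 0 < y → y ≤ ω ^ (τ + σ) → δ + y ∉ Der B A := by
        rintro y hy hyσ ⟨-, h⟩
        obtain ⟨w, hwB, hw1, hw2, hwA⟩ := h δ (by simpa using hy)
        obtain ⟨x, rfl⟩ := exists_add_of_le hw1.le
        have hx0 : x ≠ 0 := by rintro rfl; simp at hw1
        have hxy : x < y := by simpa using hw2
        have hxσ := hxy.trans_le hyσ
        change ell (δ + x) ∈ A at hwA
        rw [ell_add _ hx0] at hwA
        obtain ⟨q, hq, r, hr, rfl⟩ := lt_mul_iff.1 (show x < ω ^ τ * ω ^ σ by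
          rw [← opow_add]; exact hxσ)
        rcases eq_or_ne r 0 with rfl | hr0
        · simp only [add_zero] at *
          have hl : τ ≤ ell (ω ^ τ * q) := ell_le_of_dvd hx0 (dvd_mul_right _ _)
          refine c2 ⟨(mem_offset hP hxσ hl).1 hwB, _, hwA, hl, ?_⟩
          exact (opow_lt_opow_iff_right one_lt_omega0).1
            (lt_of_le_of_lt (omega_ell_le hx0) hxσ)
        · rw [ell_add _ hr0] at hwA
          rw [← add_assoc] at hwB
          exact c1 ⟨r, pos_iff_ne_zero.2 hr0, hr, (hP q hq r hr).1 hwB, hwA⟩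
      refine ⟨τ, le_rfl, hττ, fun q hq hlt => ?_⟩
      have h1 := hfalse _ (mul_pos (omega_pow_pos τ) hq) hlt.le
      have h2 := hfalse _ (omega_pow_pos τ) ((opow_le_opow_iff_right one_lt_omega0).2 hττ.le)
      exact ⟨fun h => (h1 h).elim, fun h => (h2 h).elim⟩

theorem Extd_offset {B : Set Ordinal} {δ τ σ y : Ordinal}
    (hP : Per B δ (ω ^ τ) (ω ^ σ)) (hy : y ≤ ω ^ (τ + σ)) (hτ : τ < ell y) :
    δ + y ∈ Extd B ↔ δ ∈ B := by
  have hy0 : y ≠ 0 := by rintro rfl; simp [ell_zero] at hτ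
  constructor
  · intro h
    obtain ⟨w, hwB, hw1, hw2, hwt⟩ := h τ (by rwa [ell_add _ hy0]) δ
      (by simpa using pos_iff_ne_zero.2 hy0)
    obtain ⟨x, rfl⟩ := exists_add_of_le hw1.le
    have hx0 : x ≠ 0 := by rintro rfl; simp at hw1
    have hxy : x < y := by simpa using hw2
    rw [ell_add _ hx0] at hwt
    exact (mem_offset hP (hxy.trans_le hy) hwt).1 hwB
  · intro hδ t ht γ hγ
    rw [ell_add _ hy0] at ht
    obtain ⟨w, h1, h2, h3, h4⟩ := exists_mem_ell hP hδ (le_max_left τ t) (max_lt hτ ht) hy hγ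
    exact ⟨w, h1, h2, h3, by rw [h4]; exact le_max_right _ _⟩

theorem Extd_mem_H0 {B : Set Ordinal} {Ω : Ordinal} (hB : B ∈ H0 Ω) :
    Extd B ∩ Set.Iio Ω ∈ H0 Ω := by
  apply H0_of_local hB
  · intro a b x hx h
    simp only [Extd, Set.mem_ofPred_eq, ell_add _ hx.ne']
    exact forall₂_congr fun t _ => Cof_local hx h
  · intro δ τ σ hσ hP
    have hττ : τ < τ + σ := by simpa using hσ.bot_lt
    have hτ1 := limit_add_one_lt hσ hττ
    refine ⟨τ + 1, le_self_add, hτ1, fun q hq hlt => ?_⟩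
    have hne : ω ^ (τ + 1) * q ≠ 0 := mul_ne_zero (omega_pow_ne _) hq.ne'
    rw [Extd_offset hP hlt.le
        (lt_of_lt_of_le (by simp) (ell_le_of_dvd hne (dvd_mul_right _ _))),
      Extd_offset hP ((opow_le_opow_iff_right one_lt_omega0).2 hτ1.le)
        (by rw [ell_omega_pow]; simp)]

/-! ### Topology -/

section

universe u

open Topology

theorem icard_zero : icard.{u} 0 = (inferInstance : TopologicalSpace Ordinal.{u}) := by
  unfold icard
  refine le_antisymm ?_ ?_
  · intro U hU
    exact TopologicalSpace.isOpen_generateFrom_of_mem (Or.inl hU)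
  · refine le_generateFrom ?_
    rintro U (hU | ⟨m, h1, h2, -⟩)
    · exact hU
    · omega

theorem ell_le_of_between {c e x : Ordinal} (h1 : c < x) (h2 : x ≤ c + ω ^ e) : ell x ≤ e := by
  obtain ⟨s, rfl⟩ := exists_add_of_le h1.le
  have hs0 : s ≠ 0 := by rintro rfl; simp at h1
  have hs : s ≤ ω ^ e := by simpa using h2
  rw [ell_add _ hs0]
  exact (opow_le_opow_iff_right one_lt_omega0).1 ((omega_ell_le hs0).trans hs)

theorem isOpen_ell_lt (β : Ordinal) : IsOpen {x : Ordinal | ell x < β} := by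
  rw [SuccOrder.isOpen_iff]
  intro x hx hlim
  obtain ⟨c, hc⟩ := exists_ell_split (x := x) hlim.ne_bot
  refine ⟨c, ?_, ?_⟩
  · conv_rhs => rw [hc]
    simpa using omega_pow_pos (ell x)
  · rintro y ⟨hy1, hy2⟩
    have : ell y ≤ ell x := ell_le_of_between hy1 (by rw [← hc]; exact hy2.le)
    exact lt_of_le_of_lt this hx

theorem icard_succ (i : ℕ) : icard.{u} (i + 1) =
    (inferInstance : TopologicalSpace Ordinal.{u}) ⊓ TopologicalSpace.induced ell (icard i) := by
  refine le_antisymm (le_inf ?_ ?_) ?_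
  · intro U hU
    exact TopologicalSpace.isOpen_generateFrom_of_mem (Or.inl hU)
  · rw [← continuous_iff_le_induced]
    refine continuous_generateFrom_iff.2 ?_
    rintro U (hU | ⟨m, h1, h2, β, rfl⟩)
    · have hcont : @Continuous _ _ (icard.{u} (i + 1)) inferInstance ell := by
        rw [OrderTopology.topology_eq_generate_intervals (α := Ordinal.{u})]
        refine continuous_generateFrom_iff.2 ?_
        rintro V ⟨β, rfl | rfl⟩
        · exact TopologicalSpace.isOpen_generateFrom_of_mem
            (Or.inr ⟨1, le_rfl, by omega, β, rfl⟩)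
        · exact TopologicalSpace.isOpen_generateFrom_of_mem (Or.inl (isOpen_ell_lt β))
      exact continuous_def.1 hcont U hU
    · refine TopologicalSpace.isOpen_generateFrom_of_mem
        (Or.inr ⟨m + 1, by omega, by omega, β, ?_⟩)
      ext x
      simp
  · refine le_generateFrom ?_
    rintro U (hU | ⟨m, h1, h2, β, rfl⟩)
    · exact (inf_le_left : (inferInstance : TopologicalSpace Ordinal.{u}) ⊓
        TopologicalSpace.induced ell (icard i) ≤ _) U hU
    · refine (inf_le_right : (inferInstance : TopologicalSpace Ordinal.{u}) ⊓
        TopologicalSpace.induced ell (icard i) ≤ _) _ ?_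
      obtain ⟨m, rfl⟩ := Nat.exists_eq_add_of_le' h1
      rcases Nat.eq_zero_or_pos m with rfl | hm
      · exact ⟨Set.Ioi β, TopologicalSpace.isOpen_generateFrom_of_mem (Or.inl (isOpen_Ioi : IsOpen (Set.Ioi β))), rfl⟩
      · exact ⟨{α | β < ell^[m] α}, TopologicalSpace.isOpen_generateFrom_of_mem
          (Or.inr ⟨m, hm, by omega, β, rfl⟩), rfl⟩

theorem icard_le (i : ℕ) : icard.{u} i ≤ (inferInstance : TopologicalSpace Ordinal.{u}) := by
  intro U hU
  exact TopologicalSpace.isOpen_generateFrom_of_mem (Or.inl hU)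

theorem mem_dSet_iff {X : Type*} (t : TopologicalSpace X) (z : X) (V : Set X) :
    z ∈ dSet t V ↔ ∀ U, IsOpen[t] U → z ∈ U → ∃ w ∈ V, w ∈ U ∧ w ≠ z := by
  change AccPt z (𝓟 V) ↔ _
  rw [accPt_iff_nhds]
  constructor
  · intro h U hU hz
    obtain ⟨w, ⟨h1, h2⟩, h3⟩ := h U (IsOpen.mem_nhds hU hz)
    exact ⟨w, h2, h1, h3⟩
  · intro h U hU
    obtain ⟨t, ht, hto, hzt⟩ := mem_nhds_iff.1 hU
    obtain ⟨w, h1, h2, h3⟩ := h t hto hzt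
    exact ⟨w, ⟨ht h2, h1⟩, h3⟩

theorem mem_dIcard_iff (i : ℕ) (z : Ordinal.{u}) (V : Set Ordinal.{u}) :
    z ∈ dIcard i V ↔ ∀ U, IsOpen[icard i] U → z ∈ U → ∃ w ∈ V, w ∈ U ∧ w ≠ z :=
  mem_dSet_iff (icard i) z V

theorem exists_of_open_inf {X Y : Type*} (t₁ : TopologicalSpace X) (t₂ : TopologicalSpace Y)
    (f : X → Y) {W : Set X} {z : X} (hW : IsOpen[t₁ ⊓ TopologicalSpace.induced f t₂] W)
    (hz : z ∈ W) : ∃ s ∈ 𝓝 z, ∃ U, IsOpen[t₂] U ∧ f z ∈ U ∧ s ∩ f ⁻¹' U ⊆ W := by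
  have hnh : W ∈ @nhds _ (t₁ ⊓ TopologicalSpace.induced f t₂) z :=
    @IsOpen.mem_nhds _ (t₁ ⊓ TopologicalSpace.induced f t₂) _ _ hW hz
  rw [nhds_inf, Filter.mem_inf_iff_superset] at hnh
  obtain ⟨s, hs, t, ht, hst⟩ := hnh
  rw [nhds_induced, Filter.mem_comap] at ht
  obtain ⟨u, hu, hut⟩ := ht
  obtain ⟨U, hUu, hUo, hzU⟩ := mem_nhds_iff.1 hu
  exact ⟨s, hs, U, hUo, hzU, fun x hx => hst ⟨hx.1, hut (hUu hx.2)⟩⟩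

theorem mem_dIcard_zero (z : Ordinal.{u}) (V : Set Ordinal.{u}) :
    z ∈ dIcard 0 V ↔ z ≠ 0 ∧ ∀ γ < z, ∃ w ∈ V, γ < w ∧ w < z := by
  have h : z ∈ dIcard 0 V ↔ AccPt z (𝓟 V) := by
    unfold dIcard dSet
    rw [icard_zero]
    rfl
  rw [h, SuccOrder.accPt_principal, isMin_iff_eq_bot]
  rfl

theorem mem_dIcard_succ (i : ℕ) (z : Ordinal.{u}) (V : Set Ordinal.{u}) :
    z ∈ dIcard (i + 1) V ↔ z ≠ 0 ∧ ∀ U, IsOpen[icard i] U → ell z ∈ U → ∀ γ < z,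
      ∃ w ∈ V, γ < w ∧ w < z ∧ ell w ∈ U := by
  rw [mem_dIcard_iff]
  have hind : ∀ U, IsOpen[icard i] U → IsOpen[icard (i + 1)] (ell ⁻¹' U) := by
    intro U hU
    rw [icard_succ]
    exact (inf_le_right : (inferInstance : TopologicalSpace Ordinal.{u}) ⊓
        TopologicalSpace.induced ell (icard i) ≤ _) _ ⟨U, hU, rfl⟩
  constructor
  · intro h
    constructor
    · rintro rfl
      obtain ⟨w, -, h1, h2⟩ := h (Set.Iio 1) (icard_le _ _ isOpen_Iio) (by simp)
      exact h2 (by simpa using h1)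
    · intro U hU hz γ hγ
      have ho : IsOpen (Set.Ioo γ (z + 1)) := isOpen_Ioo
      obtain ⟨w, h1, ⟨⟨h2, h3⟩, h4⟩, h5⟩ := h (Set.Ioo γ (z + 1) ∩ ell ⁻¹' U)
        ((icard (i + 1)).isOpen_inter _ _ (icard_le _ _ ho) (hind U hU))
        ⟨⟨hγ, by simp⟩, hz⟩
      exact ⟨w, h1, h2, lt_of_le_of_ne (Order.lt_add_one_iff.1 h3) h5, h4⟩
  · rintro ⟨hz0, h⟩ W hW hzW
    rw [icard_succ] at hW
    obtain ⟨s, hs, U, hUo, hzU, hst⟩ := exists_of_open_inf _ _ ell hW hzW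
    obtain ⟨γ, hγ, hγs⟩ := exists_Ioc_subset_of_mem_nhds hs
      ⟨0, pos_iff_ne_zero.2 hz0⟩
    obtain ⟨w, h1, h2, h3, h4⟩ := h U hUo hzU γ hγ
    exact ⟨w, h1, hst ⟨hγs ⟨h2, h3.le⟩, h4⟩, h3.ne⟩

theorem dIcard_not_succ {i : ℕ} {z : Ordinal.{u}} {A : Set Ordinal.{u}} (h : z ∈ dIcard i A) :
    Order.IsSuccLimit z := by
  by_contra hl
  have ho : IsOpen ({z} : Set Ordinal.{u}) := SuccOrder.isOpen_singleton_iff.2 hl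
  obtain ⟨w, -, h1, h2⟩ := (mem_dIcard_iff i z A).1 h {z} (icard_le i _ ho) rfl
  exact h2 h1

/-- Main computation of the derivative. -/
theorem dIcard_succ_inter {Ω : Ordinal.{u}} {B A : Set Ordinal.{u}} (hB : B ∈ H0 Ω) (i : ℕ) :
    dIcard (i + 1) (B ∩ {α | α < Ω ∧ ell α ∈ A}) ∩ Set.Iio Ω =
      (Extd B ∩ Set.Iio Ω) ∩ {α | α < Ω ∧ ell α ∈ dIcard i A ∩ Set.Iio Ω} := by
  ext z
  constructor
  · rintro ⟨hz, hzΩ⟩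
    obtain ⟨hz0, h⟩ := (mem_dIcard_succ i z _).1 hz
    have hzlim := dIcard_not_succ hz
    have hΩ : ell z < Ω := lt_of_le_of_lt
      ((right_le_opow _ one_lt_omega0).trans (omega_ell_le hz0)) hzΩ
    obtain ⟨c, hc⟩ := exists_ell_split hz0
    have hcz : c < z := by
      conv_rhs => rw [hc]
      simpa using omega_pow_pos (ell z)
    have hlt : ∀ w, c < w → w < z → ell w < ell z := by
      intro w h1 h2
      obtain ⟨s, rfl⟩ := exists_add_of_le h1.le
      have hs0 : s ≠ 0 := by rintro rfl; simp at h1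
      rw [ell_add _ hs0]
      have hs : s < ω ^ ell z := by
        have h2' := h2.trans_eq hc
        simpa using h2'
      exact (opow_lt_opow_iff_right one_lt_omega0).1 (lt_of_le_of_lt (omega_ell_le hs0) hs)
    have hd : ell z ∈ dIcard i A := by
      rw [mem_dIcard_iff]
      intro U hU hzU
      obtain ⟨w, ⟨-, -, hwA⟩, h1, h2, h3⟩ := h U hU hzU c hcz
      exact ⟨ell w, hwA, h3, (hlt w h1 h2).ne⟩
    refine ⟨⟨?_, hzΩ⟩, hzΩ, hd, hΩ⟩
    intro t ht γ hγ
    obtain ⟨w, ⟨hwB, -⟩, h1, h2, h3⟩ :=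
      h (Set.Ioi t) (icard_le i _ isOpen_Ioi) ht γ hγ
    exact ⟨w, hwB, h1, h2, le_of_lt h3⟩
  · rintro ⟨⟨hE, hzΩ⟩, -, hd, -⟩
    change z < Ω at hzΩ
    refine ⟨?_, hzΩ⟩
    have hρ := dIcard_not_succ hd
    have hz0 : z ≠ 0 := by
      rintro rfl
      rw [ell_zero] at hρ
      exact hρ.ne_bot rfl
    have hzlim : Order.IsSuccLimit z := by
      rw [Ordinal.isSuccLimit_iff]
      refine ⟨hz0, isSuccPrelimit_iff_omega0_dvd.2 ?_⟩
      have := dvd_of_le_ell (x := z) (e := 1) (one_lt_of_isSuccLimit hρ).le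
      simpa using this
    rcases up_normal (hB.2 z hzΩ.le hzlim) with ⟨δ, π, hπ, hze, -⟩ | ⟨δ, τ, σ, hσ, hze, hP⟩
    · exfalso
      rw [hze, mul_omega_eq_s19 hπ.ne', ell_add _ (omega_pow_ne _), ell_omega_pow] at hρ
      simp at hρ
    · have hell : ell z = τ + σ := by
        rw [hze, ell_add _ (omega_pow_ne _), ell_omega_pow]
      have hP' : Per B δ (ω ^ τ) (ω ^ σ) := by
        intro γ hγ ξ hξ
        have hb : ∀ γ < ω ^ σ, δ + ω ^ τ * γ + ξ < z := fun γ hγ => by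
          rw [hze, add_assoc, opow_add]
          gcongr
          exact lt_mul_iff.2 ⟨γ, hγ, ξ, hξ, rfl⟩
        have h1 := hb γ hγ
        have h2 := hb 0 (omega_pow_pos _)
        simp only [mul_zero, add_zero] at h2
        have := hP γ hγ ξ hξ
        simpa only [Set.mem_inter_iff, Set.mem_Iio, h1, h2, and_true] using this
      have hττ : τ < τ + σ := by simpa using hσ.bot_lt
      have hδ : δ ∈ B := by
        rw [hze] at hE
        exact (Extd_offset hP' le_rfl (by rw [ell_omega_pow]; exact hττ)).1 hE
      rw [mem_dIcard_succ]
      refine ⟨hz0, fun U hU hzU γ hγ => ?_⟩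
      obtain ⟨η, hηA, ⟨hηU, hη1, hη2⟩, hηne⟩ := (mem_dIcard_iff i _ A).1 hd
        (U ∩ Set.Ioo τ (ell z + 1))
        ((icard i).isOpen_inter _ _ hU (icard_le _ _ isOpen_Ioo))
        ⟨hzU, by rw [hell]; exact hττ, by simp⟩
      have hη : η < ell z := lt_of_le_of_ne (Order.lt_add_one_iff.1 hη2) hηne
      obtain ⟨w, h1, h2, h3, h4⟩ := exists_mem_ell (y := ω ^ (τ + σ)) hP' hδ hη1.le
        (by rw [ell_omega_pow, ← hell]; exact hη) le_rfl (by rw [← hze]; exact hγ)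
      rw [← hze] at h3
      exact ⟨w, ⟨h1, h3.trans hzΩ, by rw [h4]; exact hηA⟩, h2, h3, by rw [h4]; exact hηU⟩

theorem dIcard_zero_inter {Ω : Ordinal.{u}} {B A : Set Ordinal.{u}} :
    dIcard 0 (B ∩ {α | α < Ω ∧ ell α ∈ A}) ∩ Set.Iio Ω = Der B A ∩ Set.Iio Ω := by
  ext z
  simp only [Set.mem_inter_iff, Set.mem_Iio]
  refine and_congr_left fun hz => ?_
  rw [mem_dIcard_zero]
  refine and_congr_right fun _ => forall₂_congr fun γ _ => ?_
  constructor
  · rintro ⟨w, ⟨h1, -, h2⟩, h3, h4⟩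
    exact ⟨w, h1, h3, h4, h2⟩
  · rintro ⟨w, h1, h3, h4, h2⟩
    exact ⟨w, ⟨h1, h4.trans hz, h2⟩, h3, h4⟩

/-! ### Assembling -/

theorem dIcard_sUnion (i : ℕ) (F : Finset (Set Ordinal.{u})) :
    dIcard i (⋃₀ ↑F) = ⋃ S ∈ F, dIcard i S := by
  classical
  induction F using Finset.induction_on with
  | empty =>
    ext z
    simp only [Finset.coe_empty, Set.sUnion_empty, mem_dIcard_iff]
    simp only [Set.mem_empty_iff_false, false_and, exists_false, imp_false, Finset.notMem_empty,
      Set.iUnion_of_empty, Set.iUnion_empty, iff_false]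
    intro h
    exact h Set.univ (@isOpen_univ _ (icard i)) (Set.mem_univ _)
  | insert S F hS ih =>
    rw [Finset.coe_insert, Set.sUnion_insert, Finset.set_biUnion_insert, ← ih]
    ext z
    change @AccPt _ (icard i) z (𝓟 (S ∪ ⋃₀ ↑F)) ↔
      @AccPt _ (icard i) z (𝓟 S) ∨ @AccPt _ (icard i) z (𝓟 (⋃₀ ↑F))
    rw [← Filter.sup_principal]
    exact @accPt_sup _ (icard i) _ _ _

theorem Hn_biUnion {i : ℕ} {Ω : Ordinal.{u}} (F : Finset (Set Ordinal.{u}))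
    (f : Set Ordinal.{u} → Set Ordinal.{u}) (h : ∀ S ∈ F, f S ∈ Hn i Ω) :
    (⋃ S ∈ F, f S) ∈ Hn i Ω := by
  classical
  choose! G hG1 hG2 using h
  refine ⟨F.biUnion G, ?_, ?_⟩
  · intro T hT
    simp only [Finset.coe_biUnion, Set.mem_iUnion, Finset.mem_coe] at hT
    obtain ⟨S, hS, hT⟩ := hT
    exact hG1 S hS hT
  · ext z
    simp only [Set.mem_iUnion, Set.mem_sUnion, Finset.coe_biUnion, Finset.mem_coe]
    constructor
    · rintro ⟨S, hS, hz⟩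
      rw [hG2 S hS] at hz
      obtain ⟨T, hT, hz⟩ := hz
      exact ⟨T, ⟨S, hS, hT⟩, hz⟩
    · rintro ⟨T, ⟨S, hS, hT⟩, hz⟩
      refine ⟨S, hS, ?_⟩
      rw [hG2 S hS]
      exact ⟨T, hT, hz⟩

theorem Hn_of_Vn {i : ℕ} {Ω : Ordinal.{u}} {S : Set Ordinal.{u}} (h : S ∈ Vn i Ω) :
    S ∈ Hn i Ω := ⟨{S}, by simpa using h, by simp⟩

theorem dIcard_Vn (Ω : Ordinal.{u}) (n : ℕ) : ∀ V ∈ Vn n Ω, ∀ i ≤ n,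
    dIcard i V ∩ Set.Iio Ω ∈ Hn i Ω := by
  induction n with
  | zero =>
    intro V hV i hi
    obtain rfl : i = 0 := by omega
    have hVe : V = V ∩ {α | α < Ω ∧ ell α ∈ Set.univ} := by
      ext z
      exact ⟨fun h => ⟨h, hV.1 h, trivial⟩, fun h => h.1⟩
    rw [hVe, dIcard_zero_inter]
    exact Hn_of_Vn (Der_mem_H0 hV)
  | succ n ih =>
    rintro V ⟨B, hB, A, hA, rfl⟩ i hi
    cases i with
    | zero =>
      rw [dIcard_zero_inter]
      exact Hn_of_Vn (Der_mem_H0 hB)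
    | succ i =>
      rw [dIcard_succ_inter hB]
      obtain ⟨F, hF, hFe⟩ := ih A hA i (by omega)
      rw [hFe]
      have : (Extd B ∩ Set.Iio Ω) ∩ {α | α < Ω ∧ ell α ∈ ⋃₀ (↑F : Set (Set Ordinal.{u}))} =
          ⋃ S ∈ F, (Extd B ∩ Set.Iio Ω) ∩ {α | α < Ω ∧ ell α ∈ S} := by
        ext z
        simp only [Set.mem_inter_iff, Set.mem_ofPred_eq, Set.mem_sUnion, Set.mem_iUnion,
          Finset.mem_coe]
        constructor
        · rintro ⟨h1, h2, S, hS, h3⟩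
          exact ⟨S, hS, h1, h2, h3⟩
        · rintro ⟨S, hS, h1, h2, h3⟩
          exact ⟨h1, h2, S, hS, h3⟩
      rw [this]
      exact Hn_biUnion F _ fun S hS => Hn_of_Vn ⟨_, Extd_mem_H0 hB, S, hF hS, rfl⟩

end

/-- For `n > 0`: if `V ∈ H_n(Ω)` then `d_i(V) ∩ Ω ∈ H_i(Ω)` for all `i ≤ n`. -/
theorem Hn_closed_under_derivatives (Ω : Ordinal) (n : ℕ) (hn : 0 < n)
    (V : Set Ordinal) (hV : V ∈ Hn n Ω) :
    ∀ i ≤ n, dIcard i V ∩ Set.Iio Ω ∈ Hn i Ω := by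
  intro i hi
  obtain ⟨F, hF, rfl⟩ := hV
  rw [dIcard_sUnion, Set.iUnion₂_inter]
  exact Hn_biUnion F (fun S => dIcard i S ∩ Set.Iio Ω)
    fun S hS => dIcard_Vn Ω n S (hF hS) i hi
end
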